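/- arXiv:2511.10511 — 2 statements merged into one kernel-verified Lean document; each statement's English description precedes it below -/
import Mathlib

section
/- For every k ≥ 3, C^gr(N_k^{gr}) equals the T₂-ideal of F⟨Y,Z⟩ generated by the three polynomials [y₁,y₂], [z₁, y₁, y₂, …, y_{k−2}] (left-normed commutator of z₁ with k−2 even variables), and z₁z₂. -/
noncomputable section

/-- The free superalgebra `F⟨Y,Z⟩`: the free unital associative `F`-algebra on the
even variables `Sum.inl i` (representing `y_{i+1}`) and the odd variables
`Sum.inr j` (representing `z_{j+1}`). -/
abbrev FA (F : Type) [Field F] : Type := FreeAlgebra F (ℕ ⊕ ℕ)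

variable (F : Type) [Field F]

/-- the even variable `y_{i+1}` -/
def yv (i : ℕ) : FA F := FreeAlgebra.ι F (Sum.inl i)

/-- the odd variable `z_{j+1}` -/
def zv (j : ℕ) : FA F := FreeAlgebra.ι F (Sum.inr j)

/-- the constant term of an element of `F⟨Y,Z⟩` -/
def constTerm : FA F →ₐ[F] F := FreeAlgebra.lift F (fun _ => (0 : F))

/-- the commutator `[a,b] = ab - ba` -/
def brk {R : Type} [Ring R] (a b : R) : R := a * b - b * a

/-- the left-normed commutator `[a, l₁, l₂, …]` -/
def lnc {R : Type} [Ring R] (a : R) (l : List R) : R := l.foldl brk a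

section SuperAlg

variable (B : Type) [Ring B] [Algebra F B]

/-- the center of the (possibly non-unital) subalgebra of `B` whose underlying
subspace is `S`, as a submodule of `B` -/
def centerIn (S : Submodule F B) : Submodule F B where
  carrier := {x | x ∈ S ∧ ∀ y ∈ S, x * y = y * x}
  add_mem' := by
    rintro a b ⟨ha, ha'⟩ ⟨hb, hb'⟩
    exact ⟨S.add_mem ha hb, fun y hy => by rw [add_mul, mul_add, ha' y hy, hb' y hy]⟩
  zero_mem' := ⟨S.zero_mem, fun y _ => by rw [zero_mul, mul_zero]⟩
  smul_mem' := by
    rintro c a ⟨ha, ha'⟩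
    exact ⟨S.smul_mem c ha, fun y hy => by rw [smul_mul_assoc, mul_smul_comm, ha' y hy]⟩

variable (A0 A1 : Submodule F B)

/-- a graded substitution: an algebra evaluation sending each `yᵢ` into the even
component `A0` and each `zⱼ` into the odd component `A1` -/
def IsGSubst (φ : FA F →ₐ[F] B) : Prop :=
  (∀ i, φ (yv F i) ∈ A0) ∧ (∀ j, φ (zv F j) ∈ A1)

/-- the graded identities of the superalgebra with even part `A0` and odd part `A1` -/
def IdGr : Submodule F (FA F) where
  carrier := {f | ∀ φ : FA F →ₐ[F] B, IsGSubst F B A0 A1 φ → φ f = 0}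
  add_mem' := by
    intro f g hf hg φ hφ
    rw [map_add, hf φ hφ, hg φ hφ, add_zero]
  zero_mem' := fun φ _ => map_zero φ
  smul_mem' := by
    intro c f hf φ hφ
    rw [map_smul, hf φ hφ, smul_zero]

/-- the central graded polynomials of the superalgebra with even part `A0` and
odd part `A1`: the polynomials with zero constant term all of whose graded
evaluations lie in the center of the superalgebra -/
def CGr : Submodule F (FA F) where
  carrier := {f | constTerm F f = 0 ∧
    ∀ φ : FA F →ₐ[F] B, IsGSubst F B A0 A1 φ → φ f ∈ centerIn F B (A0 ⊔ A1)}
  add_mem' := by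
    rintro f g ⟨hf0, hf⟩ ⟨hg0, hg⟩
    refine ⟨by rw [map_add, hf0, hg0, add_zero], fun φ hφ => ?_⟩
    rw [map_add]
    exact (centerIn F B (A0 ⊔ A1)).add_mem (hf φ hφ) (hg φ hφ)
  zero_mem' :=
    ⟨map_zero _, fun φ _ => by
      rw [map_zero]; exact (centerIn F B (A0 ⊔ A1)).zero_mem⟩
  smul_mem' := by
    rintro c f ⟨hf0, hf⟩
    refine ⟨by rw [map_smul, hf0, smul_zero], fun φ hφ => ?_⟩
    rw [map_smul]
    exact (centerIn F B (A0 ⊔ A1)).smul_mem c (hf φ hφ)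

end SuperAlg

/-- the space `P_n^{gr}` of multilinear graded polynomials of degree `n`,
spanned by `w_{σ(1)} ⋯ w_{σ(n)}` with `wᵢ ∈ {yᵢ, zᵢ}` -/
def PnGr (n : ℕ) : Submodule F (FA F) :=
  Submodule.span F
    {m : FA F | ∃ (σ : Equiv.Perm (Fin n)) (w : Fin n → Bool),
      m = (List.ofFn fun i : Fin n =>
        if w (σ i) then zv F (σ i).val else yv F (σ i).val).prod}

/-- `dim P / (P ∩ C)` -/
def scodim (P C : Submodule F (FA F)) : ℕ :=
  Module.finrank F (↥P ⧸ Submodule.comap P.subtype C)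

/-- `dim (P ⊓ C) / (P ⊓ I)` -/
def deltaDim (P C I : Submodule F (FA F)) : ℕ :=
  Module.finrank F (↥(P ⊓ C) ⧸ Submodule.comap (P ⊓ C).subtype (P ⊓ I))

/-- the parity automorphism of `F⟨Y,Z⟩`, fixing the `yᵢ` and negating the `zⱼ` -/
def omegaFA : FA F →ₐ[F] FA F :=
  FreeAlgebra.lift F (fun v => match v with
    | Sum.inl i => FreeAlgebra.ι F (Sum.inl i)
    | Sum.inr j => - FreeAlgebra.ι F (Sum.inr j))

/-- an even (degree-0) element of the free superalgebra -/
def IsEvenFA (f : FA F) : Prop := omegaFA F f = f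

/-- an odd (degree-1) element of the free superalgebra -/
def IsOddFA (f : FA F) : Prop := omegaFA F f = - f

/-- a graded endomorphism of the free superalgebra: sends `Y`-variables to even
elements and `Z`-variables to odd elements -/
def IsT2Endo (φ : FA F →ₐ[F] FA F) : Prop :=
  (∀ i, IsEvenFA F (φ (yv F i))) ∧ (∀ j, IsOddFA F (φ (zv F j)))

/-- a T₂-space: a subspace invariant under all graded endomorphisms -/
def IsT2Space (V : Submodule F (FA F)) : Prop :=
  ∀ φ : FA F →ₐ[F] FA F, IsT2Endo F φ → ∀ f ∈ V, φ f ∈ V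

/-- the smallest T₂-space of `F⟨Y,Z⟩` containing `S` -/
def T2SpaceGen (S : Set (FA F)) : Submodule F (FA F) :=
  sInf {V : Submodule F (FA F) | S ⊆ ↑V ∧ IsT2Space F V}

/-- a T₂-ideal: a two-sided ideal invariant under all graded endomorphisms -/
def IsT2Ideal (I : Submodule F (FA F)) : Prop :=
  (∀ f ∈ I, ∀ g : FA F, g * f ∈ I ∧ f * g ∈ I) ∧ IsT2Space F I

/-- the smallest T₂-ideal of `F⟨Y,Z⟩` containing `S` -/
def T2IdealGen (S : Set (FA F)) : Submodule F (FA F) :=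
  sInf {I : Submodule F (FA F) | S ⊆ ↑I ∧ IsT2Ideal F I}

/-- the products `z_{i₁}⋯z_{i_k} · w₁⋯w_s` where every `wⱼ` is a left-normed
commutator of weight ≥ 2 in the variables and `k + s ≥ 1`; proper
ℤ₂-polynomials are the linear combinations of these -/
def properProds : Set (FA F) :=
  {p | ∃ (zs : List ℕ) (ws : List (FA F)),
      (∀ w ∈ ws, ∃ (v : ℕ ⊕ ℕ) (l : List (ℕ ⊕ ℕ)), l ≠ [] ∧
        w = lnc (FreeAlgebra.ι F v) (l.map (FreeAlgebra.ι F))) ∧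
      1 ≤ zs.length + ws.length ∧
      p = (zs.map (zv F)).prod * ws.prod}

/-- the Jacobson radical `J(A)`, as an `F`-submodule of `A` -/
def Jrad (A : Type) [Ring A] [Algebra F A] : Submodule F A :=
  Submodule.restrictScalars F ((⊥ : Ideal A).jacobson)

/-- `J' = J(A) ∩ Z(A)` -/
def Jprime (A : Type) [Ring A] [Algebra F A] : Submodule F A :=
  Jrad F A ⊓ Subalgebra.toSubmodule (Subalgebra.center F A)

/-- the matrix unit `e_{i+1,j+1}` (0-indexed position `(i,j)`) -/
def eMat (k i j : ℕ) : Matrix (Fin k) (Fin k) F :=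
  Matrix.of fun a b => if (a : ℕ) = i ∧ (b : ℕ) = j then 1 else 0

/-- the matrix `E = e_{12} + e_{23} + ⋯ + e_{k-1,k}` -/
def EMat (k : ℕ) : Matrix (Fin k) (Fin k) F :=
  Matrix.of fun a b => if (a : ℕ) + 1 = (b : ℕ) then 1 else 0

/-- `N_k = span_F{I_k, E, …, E^{k-2}, e_{12}, …, e_{1k}}` -/
def NkSub (k : ℕ) : Submodule F (Matrix (Fin k) (Fin k) F) :=
  Submodule.span F
    ({1} ∪ {x | ∃ m, 1 ≤ m ∧ m ≤ k - 2 ∧ x = EMat F k ^ m}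
      ∪ {x | ∃ j, 1 ≤ j ∧ j ≤ k - 1 ∧ x = eMat F k 0 j})

/-- `A_k = span_F{e_{11}, E, …, E^{k-2}, e_{12}, …, e_{1k}}` -/
def AkSub (k : ℕ) : Submodule F (Matrix (Fin k) (Fin k) F) :=
  Submodule.span F
    ({eMat F k 0 0} ∪ {x | ∃ m, 1 ≤ m ∧ m ≤ k - 2 ∧ x = EMat F k ^ m}
      ∪ {x | ∃ j, 1 ≤ j ∧ j ≤ k - 1 ∧ x = eMat F k 0 j})

/-- `B_k = span_F{e_{kk}, E, …, E^{k-2}, e_{1k}, …, e_{k-1,k}}` -/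
def BkSub (k : ℕ) : Submodule F (Matrix (Fin k) (Fin k) F) :=
  Submodule.span F
    ({eMat F k (k - 1) (k - 1)} ∪ {x | ∃ m, 1 ≤ m ∧ m ≤ k - 2 ∧ x = EMat F k ^ m}
      ∪ {x | ∃ i, i ≤ k - 2 ∧ x = eMat F k i (k - 1)})

/-- the even part of `Matrix (Fin k) (Fin k) F` under the elementary ℤ₂-grading
induced by `(0,1,…,1)`: matrices vanishing at the odd positions `(i,j)`
(those where exactly one of `i`, `j` equals the first index) -/
def matEvenPart (k : ℕ) : Submodule F (Matrix (Fin k) (Fin k) F) where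
  carrier := {x | ∀ i j : Fin k, (((i : ℕ) = 0) ↔ ¬((j : ℕ) = 0)) → x i j = 0}
  add_mem' := by
    intro a b ha hb i j h
    simp [Matrix.add_apply, ha i j h, hb i j h]
  zero_mem' := by intro i j _; simp
  smul_mem' := by
    intro c a ha i j h
    simp [Matrix.smul_apply, ha i j h]

/-- the odd part of `Matrix (Fin k) (Fin k) F` under the elementary ℤ₂-grading
induced by `(0,1,…,1)`: matrices vanishing at the even positions -/
def matOddPart (k : ℕ) : Submodule F (Matrix (Fin k) (Fin k) F) where
  carrier := {x | ∀ i j : Fin k, (((i : ℕ) = 0) ↔ ((j : ℕ) = 0)) → x i j = 0}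
  add_mem' := by
    intro a b ha hb i j h
    simp [Matrix.add_apply, ha i j h, hb i j h]
  zero_mem' := by intro i j _; simp
  smul_mem' := by
    intro c a ha i j h
    simp [Matrix.smul_apply, ha i j h]

section Grassmann

variable (M : Type) [AddCommGroup M] [Module F M]

/-- the main involution of the Grassmann (exterior) algebra, negating the
generators -/
def grassInvol : ExteriorAlgebra F M →ₐ[F] ExteriorAlgebra F M :=
  ExteriorAlgebra.lift F ⟨-(ExteriorAlgebra.ι F (M := M)), fun m => by
    simp [ExteriorAlgebra.ι_sq_zero]⟩

/-- the even (degree-0) part of the canonical ℤ₂-grading of the Grassmann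
algebra: the span of `1` and the products of the generators of even length -/
def grEven : Submodule F (ExteriorAlgebra F M) :=
  LinearMap.ker ((grassInvol F M).toLinearMap - LinearMap.id)

/-- the odd (degree-1) part of the canonical ℤ₂-grading of the Grassmann
algebra: the span of the products of the generators of odd length -/
def grOdd : Submodule F (ExteriorAlgebra F M) :=
  LinearMap.ker ((grassInvol F M).toLinearMap + LinearMap.id)

end Grassmann

end


section Helper
open Polynomial

/-- abstract relations: `D e = 0`, `e e = 0`, `e D^(n+1) = 0` -/
theorem aeval_mul_e {F B : Type} [Field F] [Ring B] [Algebra F B] {D e : B} (hDe : D * e = 0)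
    (p : F[X]) : aeval D p * e = p.coeff 0 • e := by
  conv_lhs => rw [← Polynomial.divX_mul_X_add p]
  simp only [map_add, map_mul, aeval_X, aeval_C, add_mul, mul_assoc, hDe, mul_zero, zero_add]
  rw [Algebra.smul_def]

theorem e_aeval_e {F B : Type} [Field F] [Ring B] [Algebra F B] {D e : B} (hDe : D * e = 0)
    (hee : e * e = 0) (p : F[X]) : e * aeval D p * e = 0 := by
  rw [mul_assoc, aeval_mul_e hDe, mul_smul_comm, hee, smul_zero]

theorem N_mul {F B : Type} [Field F] [Ring B] [Algebra F B] {D e : B} (hDe : D * e = 0)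
    (hee : e * e = 0) (p q p' q' : F[X]) :
    (aeval D p + e * aeval D q) * (aeval D p' + e * aeval D q') =
      aeval D (p * p') + e * aeval D (p.coeff 0 • q' + q * p') := by
  have h1 := aeval_mul_e hDe p
  have h2 := e_aeval_e hDe hee q
  simp only [map_add, map_mul, map_smul, add_mul, mul_add]
  rw [← mul_assoc (aeval D p) e, h1, ← mul_assoc (e * aeval D q) e, h2]
  simp only [zero_mul, add_zero, smul_mul_assoc, mul_smul_comm, mul_assoc]
  abel

theorem e_top {F B : Type} [Field F] [Ring B] [Algebra F B] {D e : B} {n : ℕ}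
    (hn : e * D ^ (n + 1) = 0) (q : F[X]) :
    e * aeval D (X ^ n * q) = q.coeff 0 • (e * D ^ n) := by
  conv_lhs => rw [← Polynomial.divX_mul_X_add q, mul_comm q.divX, mul_add, ← mul_assoc, ← pow_succ]
  simp only [map_add, map_mul, map_pow, aeval_X, aeval_C, mul_add, ← mul_assoc, hn, zero_mul,
    zero_add]
  rw [Algebra.smul_def, Algebra.commutes]

theorem lnc_val {F B : Type} [Field F] [Ring B] [Algebra F B] {D e : B} (hDe : D * e = 0)
    (l : List B) (hl : ∀ b ∈ l, ∃ p : F[X], b = aeval D p) (m : ℕ) (q : F[X]) :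
    ∃ q' : F[X], lnc (e * aeval D (X ^ m * q)) l = e * aeval D (X ^ (m + l.length) * q') := by
  induction l generalizing m q with
  | nil => exact ⟨q, rfl⟩
  | cons b l ih =>
    obtain ⟨p, rfl⟩ := hl b (by simp)
    have key : brk (e * aeval D (X ^ m * q)) (aeval D p)
        = e * aeval D (X ^ (m + 1) * (q * p.divX)) := by
      unfold brk
      rw [← mul_assoc (aeval D p), aeval_mul_e hDe, smul_mul_assoc, ← mul_smul_comm, mul_assoc,
        ← map_mul, ← map_smul, ← mul_sub, ← map_sub]
      congr 2
      conv_lhs => rw [← Polynomial.divX_mul_X_add p]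
      simp [Polynomial.smul_eq_C_mul]
      ring
    obtain ⟨q', h⟩ := ih (fun b hb => hl b (by simp [hb])) (m + 1) (q * p.divX)
    refine ⟨q', ?_⟩
    show lnc (brk (e * aeval D (X ^ m * q)) (aeval D p)) l = _
    rw [key, h]
    rw [List.length_cons, add_assoc, add_comm 1]

theorem exists_ev {F σ A : Type} [Field F] [Ring A] [Algebra F A] (v : σ → A)
    (h : ∀ i j, v i * v j = v j * v i) :
    ∃ ev : MvPolynomial σ F →ₐ[F] A, ∀ i, ev (MvPolynomial.X i) = v i := by
  have hc : ∀ a ∈ Set.range v, ∀ b ∈ Set.range v, a * b = b * a := by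
    rintro _ ⟨i, rfl⟩ _ ⟨j, rfl⟩; exact h i j
  have hm := Algebra.isMulCommutative_adjoin F hc
  let _ : CommRing (Algebra.adjoin F (Set.range v)) :=
    { (inferInstance : Ring (Algebra.adjoin F (Set.range v))) with
      mul_comm := fun a b => hm.is_comm.comm a b }
  refine ⟨(Algebra.adjoin F (Set.range v)).val.comp
    (MvPolynomial.aeval (fun i => (⟨v i, Algebra.subset_adjoin ⟨i, rfl⟩⟩ : Algebra.adjoin F (Set.range v)))), ?_⟩
  intro i
  simp

/-- the weight: degree in the second block -/
def wt2 : ℕ ⊕ ℕ → ℕ := Sum.elim (fun _ => 0) (fun _ => 1)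

theorem monomial_split {F : Type} [Field F] (n : ℕ) (d : ℕ ⊕ ℕ →₀ ℕ)
    (h : n ≤ Finsupp.weight wt2 d) :
    ∃ (l : List ℕ) (d' : ℕ ⊕ ℕ →₀ ℕ), l.length = n ∧
      MvPolynomial.monomial d (1 : F) = MvPolynomial.monomial d' 1 *
        (l.map (fun i => MvPolynomial.X (Sum.inr i))).prod := by
  induction n generalizing d with
  | zero => exact ⟨[], d, rfl, by simp⟩
  | succ n ih =>
    have : ∃ i, d (Sum.inr i) ≠ 0 := by
      by_contra! hc
      have : Finsupp.weight wt2 d = 0 := by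
        rw [Finsupp.weight_apply, Finsupp.sum]
        apply Finset.sum_eq_zero
        rintro (i | i) _
        · simp [wt2]
        · simp [hc]
      omega
    obtain ⟨i, hi⟩ := this
    have hd : d = (d - Finsupp.single (Sum.inr i) 1) + Finsupp.single (Sum.inr i) 1 := by
      rw [tsub_add_cancel_of_le]
      rw [Finsupp.single_le_iff]; omega
    set d1 := d - Finsupp.single (Sum.inr i) 1
    have hw : Finsupp.weight wt2 d = Finsupp.weight wt2 d1 + 1 := by
      rw [hd, map_add, Finsupp.weight_single]; simp [wt2]
    obtain ⟨l, d', hl, he⟩ := ih d1 (by omega)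
    refine ⟨i :: l, d', by simp [hl], ?_⟩
    rw [hd, List.map_cons, List.prod_cons, mul_left_comm, ← he, MvPolynomial.X,
      MvPolynomial.monomial_mul, add_comm]
    simp

theorem coeff_zero_of {F : Type} [Field F] [CharZero F] (n : ℕ) (g : MvPolynomial (ℕ ⊕ ℕ) F)
    (h : ∀ t s : ℕ → F, ∀ m < n, (MvPolynomial.aeval
      (Sum.elim (fun i => C (t i)) (fun i => C (s i) * X) : ℕ ⊕ ℕ → F[X]) g).coeff m = 0)
    (d : ℕ ⊕ ℕ →₀ ℕ) (hd : Finsupp.weight wt2 d < n) : MvPolynomial.coeff d g = 0 := by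
  have key : ∀ (r : ℕ ⊕ ℕ → F) (m : ℕ), MvPolynomial.eval r
      (MvPolynomial.weightedHomogeneousComponent wt2 m g) = (MvPolynomial.aeval
      (fun i => C (r i) * X ^ (wt2 i) : ℕ ⊕ ℕ → F[X]) g).coeff m := by
    intro r m
    clear h
    induction g using MvPolynomial.induction_on' with
    | add p q hp hq => simp [map_add, hp, hq]
    | monomial u a =>
      have h1 : MvPolynomial.weightedHomogeneousComponent wt2 m (MvPolynomial.monomial u a) =
          if Finsupp.weight wt2 u = m then MvPolynomial.monomial u a else 0 := by
        ext e
        rw [MvPolynomial.coeff_weightedHomogeneousComponent]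
        by_cases hue : u = e
        · subst hue
          split_ifs <;> simp
        · split_ifs <;> simp [MvPolynomial.coeff_monomial, hue]
      have h2 : MvPolynomial.aeval (fun i => C (r i) * X ^ (wt2 i) : ℕ ⊕ ℕ → F[X])
          (MvPolynomial.monomial u a) =
          C (MvPolynomial.eval r (MvPolynomial.monomial u a)) * X ^ (Finsupp.weight wt2 u) := by
        rw [MvPolynomial.aeval_monomial, MvPolynomial.eval_monomial, Finsupp.weight_apply]
        simp only [Finsupp.prod, Finsupp.sum, mul_pow, Finset.prod_mul_distrib, map_mul, map_prod,
          map_pow, ← pow_mul, Finset.prod_pow_eq_pow_sum, mul_comm (wt2 _), smul_eq_mul, mul_assoc]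
        rfl
      rw [h1, h2, coeff_C_mul_X_pow]
      split_ifs with h3 h4 h4 <;> first | rfl | omega | simp
  have hK : MvPolynomial.weightedHomogeneousComponent wt2 (Finsupp.weight wt2 d) g = 0 := by
    apply MvPolynomial.funext
    intro r
    rw [key, map_zero, ← h (fun i => r (Sum.inl i)) (fun i => r (Sum.inr i)) _ hd]
    congr 2
    congr 1
    ext i : 1
    rcases i with i | i <;> simp [wt2]
  have := congrArg (MvPolynomial.coeff d) hK
  rw [MvPolynomial.coeff_weightedHomogeneousComponent] at this
  simpa using this

theorem const_of {F : Type} [Field F] [CharZero F] (p : MvPolynomial ℕ F)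
    (h : ∀ t s : ℕ → F, (MvPolynomial.aeval (fun i => C (t i) + C (s i) * X : ℕ → F[X]) p).coeff 1 = 0) :
    p = MvPolynomial.C (MvPolynomial.eval 0 p) := by
  apply MvPolynomial.funext
  intro s
  rw [MvPolynomial.eval_C]
  set q : F[X] := MvPolynomial.aeval (fun i => C (s i) * X : ℕ → F[X]) p with hq
  have hev : ∀ c : F, q.eval c = MvPolynomial.eval (fun i => s i * c) p := by
    intro c
    have : (Polynomial.aeval c).comp (MvPolynomial.aeval (fun i => C (s i) * X : ℕ → F[X])) =
        MvPolynomial.aeval (fun i => s i * c) := by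
      ext i; simp
    have := DFunLike.congr_fun this p
    simpa [Polynomial.aeval_def, MvPolynomial.aeval_eq_eval] using this
  have hder : derivative q = 0 := by
    apply Polynomial.funext
    intro c
    have := h (fun i => s i * c) s
    rw [eval_zero, ← this]
    have h2 : MvPolynomial.aeval (fun i => C (s i * c) + C (s i) * X : ℕ → F[X]) p = taylor c q := by
      have : (taylorAlgHom c).comp (MvPolynomial.aeval (fun i => C (s i) * X : ℕ → F[X])) =
          MvPolynomial.aeval (fun i => C (s i * c) + C (s i) * X : ℕ → F[X]) := by
        ext i : 1; simp [mul_add, add_comm]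
      exact (DFunLike.congr_fun this p).symm
    rw [h2, taylor_coeff_one]
  have hc := Polynomial.derivative_eq_zero.mp hder
  obtain ⟨a, ha⟩ := Polynomial.natDegree_eq_zero.mp hc
  have h0 := hev 0
  have h1 := hev 1
  rw [← ha] at h0 h1
  simp at h0 h1
  rw [← h1, h0, ← MvPolynomial.eval_zero]

theorem odd_mem_ev {F R : Type} [Field F] [Ring R] [Algebra F R] (π : FA F →ₐ[F] R)
    (ev : MvPolynomial (ℕ ⊕ ℕ) F →ₐ[F] Module.End F R)
    (hev1 : ∀ i x, ev (MvPolynomial.X (Sum.inl i)) x = π (yv F i) * x)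
    (hev2 : ∀ i x, ev (MvPolynomial.X (Sum.inr i)) x = x * π (yv F i) - π (yv F i) * x)
    (q : MvPolynomial (ℕ ⊕ ℕ) F) :
    ∀ x, (∃ a, IsOddFA F a ∧ π a = x) → ∃ a, IsOddFA F a ∧ π a = ev q x := by
  have hy : ∀ i, omegaFA F (yv F i) = yv F i := by intro i; simp [omegaFA, yv]
  induction q using MvPolynomial.induction_on with
  | C a =>
    rintro x ⟨b, hb, rfl⟩
    refine ⟨a • b, ?_, ?_⟩
    · unfold IsOddFA at *; rw [map_smul, hb, smul_neg]
    · have : ev (MvPolynomial.C a) = algebraMap F _ a := ev.commutes a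
      rw [this, map_smul]; rfl
  | add p q hp hq =>
    intro x hx
    obtain ⟨a, ha, ha'⟩ := hp x hx
    obtain ⟨b, hb, hb'⟩ := hq x hx
    refine ⟨a + b, ?_, ?_⟩
    · unfold IsOddFA at *; rw [map_add, ha, hb, neg_add]
    · rw [map_add, map_add, ha', hb']; rfl
  | mul_X p i hp =>
    rintro x ⟨b, hb, rfl⟩
    rw [map_mul]
    apply hp
    unfold IsOddFA at *
    rcases i with i | i
    · refine ⟨yv F i * b, ?_, ?_⟩
      · rw [map_mul, hb, hy, mul_neg]
      · rw [hev1, map_mul]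
    · refine ⟨b * yv F i - yv F i * b, ?_, ?_⟩
      · rw [map_sub, map_mul, map_mul, hb, hy]; noncomm_ring
      · rw [hev2, map_sub, map_mul, map_mul]

/-- right variable substitution `y ↦ u + w` -/
noncomputable def rhoQ (F : Type) [Field F] : MvPolynomial ℕ F →ₐ[F] MvPolynomial (ℕ ⊕ ℕ) F :=
  MvPolynomial.aeval (fun i => MvPolynomial.X (Sum.inl i) + MvPolynomial.X (Sum.inr i))

/-- left variable substitution `y ↦ u` -/
noncomputable def lamQ (F : Type) [Field F] : MvPolynomial ℕ F →ₐ[F] MvPolynomial (ℕ ⊕ ℕ) F :=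
  MvPolynomial.aeval (fun i => MvPolynomial.X (Sum.inl i))

/-- evaluation of commutative polynomials at `t + sX` -/
noncomputable def evP {F : Type} [Field F] (t s : ℕ → F) : MvPolynomial ℕ F →ₐ[F] F[X] :=
  MvPolynomial.aeval (fun i => C (t i) + C (s i) * X)

/-- evaluation of two-block polynomials at `(t, sX)` -/
noncomputable def evQ {F : Type} [Field F] (t s : ℕ → F) : MvPolynomial (ℕ ⊕ ℕ) F →ₐ[F] F[X] :=
  MvPolynomial.aeval (Sum.elim (fun i => C (t i)) (fun i => C (s i) * X))

theorem evQ_rho {F : Type} [Field F] (t s : ℕ → F) (p : MvPolynomial ℕ F) :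
    evQ t s (rhoQ F p) = evP t s p := by
  have : (evQ t s).comp (rhoQ F) = evP t s := by
    ext i : 1; simp [evQ, rhoQ, evP]
  exact DFunLike.congr_fun this p

theorem evQ_lam {F : Type} [Field F] (t s : ℕ → F) (p : MvPolynomial ℕ F) :
    evQ t s (lamQ F p) = C ((evP t s p).coeff 0) := by
  have : (evQ t s).comp (lamQ F) =
      ((Algebra.ofId F F[X]).comp (Polynomial.aeval (0 : F))).comp (evP t s) := by
    ext i : 1; simp [evQ, lamQ, evP, Algebra.ofId_apply]
  have := DFunLike.congr_fun this p
  simpa [Algebra.ofId_apply, Polynomial.coeff_zero_eq_aeval_zero] using this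

/-- assembling a family of two-block polynomials -/
noncomputable def asm {F Q M : Type} [Field F] [AddCommGroup Q] [Module F Q] [AddCommGroup M] [Module F M]
    (T : ℕ → Q →ₗ[F] M) : (ℕ →₀ Q) →ₗ[F] M := Finsupp.lsum F T

theorem asm_single {F Q M : Type} [Field F] [AddCommGroup Q] [Module F Q] [AddCommGroup M]
    [Module F M] (T : ℕ → Q →ₗ[F] M) (j : ℕ) (q : Q) : asm T (Finsupp.single j q) = T j q := by
  simp [asm]

/-- the matrix side coefficient -/
noncomputable def asmX {F : Type} [Field F] (t s c : ℕ → F) :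
    (ℕ →₀ MvPolynomial (ℕ ⊕ ℕ) F) →ₗ[F] F[X] :=
  asm (fun j => c j • (evQ t s).toLinearMap)

/-- the quotient side -/
noncomputable def asmR {F R : Type} [Field F] [Ring R] [Algebra F R] (π : FA F →ₐ[F] R)
    (ev : MvPolynomial (ℕ ⊕ ℕ) F →ₐ[F] Module.End F R) :
    (ℕ →₀ MvPolynomial (ℕ ⊕ ℕ) F) →ₗ[F] R :=
  asm (fun j => (LinearMap.applyₗ (π (zv F j))).comp ev.toLinearMap)

theorem asmX_smul {F : Type} [Field F] (t s c : ℕ → F) (a : MvPolynomial (ℕ ⊕ ℕ) F)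
    (g : ℕ →₀ MvPolynomial (ℕ ⊕ ℕ) F) : asmX t s c (a • g) = evQ t s a * asmX t s c g := by
  induction g using Finsupp.induction_linear with
  | zero => simp
  | add f g hf hg => rw [smul_add, map_add, map_add, hf, hg, mul_add]
  | single j q =>
    rw [Finsupp.smul_single, asmX, asm_single, asm_single]
    simp

theorem asmR_smul {F R : Type} [Field F] [Ring R] [Algebra F R] (π : FA F →ₐ[F] R)
    (ev : MvPolynomial (ℕ ⊕ ℕ) F →ₐ[F] Module.End F R) (a : MvPolynomial (ℕ ⊕ ℕ) F)
    (g : ℕ →₀ MvPolynomial (ℕ ⊕ ℕ) F) : asmR π ev (a • g) = ev a (asmR π ev g) := by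
  induction g using Finsupp.induction_linear with
  | zero => simp
  | add f g hf hg => rw [smul_add, map_add, map_add, hf, hg, map_add]
  | single j q =>
    rw [Finsupp.smul_single, asmR, asm_single, asm_single]
    simp

theorem main_rep {F R B : Type} [Field F] [Ring R] [Algebra F R] [Ring B] [Algebra F B]
    (π : FA F →ₐ[F] R)
    (h2 : ∀ a b, IsOddFA F a → IsOddFA F b → π a * π b = 0)
    (ψ : MvPolynomial ℕ F →ₐ[F] R) (hψ : ∀ i, ψ (MvPolynomial.X i) = π (yv F i))
    (ev : MvPolynomial (ℕ ⊕ ℕ) F →ₐ[F] Module.End F R)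
    (hev1 : ∀ i x, ev (MvPolynomial.X (Sum.inl i)) x = π (yv F i) * x)
    (hev2 : ∀ i x, ev (MvPolynomial.X (Sum.inr i)) x = x * π (yv F i) - π (yv F i) * x)
    {D e : B} (hDe : D * e = 0) (hee : e * e = 0) (f : FA F) :
    ∃ (p : MvPolynomial ℕ F) (g : ℕ →₀ MvPolynomial (ℕ ⊕ ℕ) F),
      π f = ψ p + asmR π ev g ∧ constTerm F f = MvPolynomial.eval 0 p ∧
      ∀ (t s c : ℕ → F) (φ : FA F →ₐ[F] B), (∀ i, φ (yv F i) = aeval D (C (t i) + C (s i) * X)) →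
        (∀ j, φ (zv F j) = c j • e) →
        φ f = aeval D (evP t s p) + e * aeval D (asmX t s c g) := by
  have hlam : ∀ p x, ev (lamQ F p) x = ψ p * x := by
    have : ev.comp (lamQ F) = (Algebra.lmul F R).comp ψ := by
      ext i x
      simp [lamQ, hψ, hev1]
    intro p x
    exact LinearMap.congr_fun (DFunLike.congr_fun this p) x
  have hrho : ∀ p x, ev (rhoQ F p) x = x * ψ p := by
    intro p
    induction p using MvPolynomial.induction_on with
    | C a =>
      intro x
      have h3 : ev (rhoQ F (MvPolynomial.C a)) = algebraMap F _ a := (ev.comp (rhoQ F)).commutes a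
      have h4 : ψ (MvPolynomial.C a) = algebraMap F _ a := ψ.commutes a
      rw [h3, h4, ← Algebra.commutes, ← Algebra.smul_def]; rfl
    | add p q hp hq => intro x; rw [map_add, map_add, map_add, mul_add, ← hp, ← hq]; rfl
    | mul_X p i hp =>
      intro x
      have h3 : ev (rhoQ F (MvPolynomial.X i)) x = x * π (yv F i) := by
        simp [rhoQ, hev1, hev2]
      have h5 : ψ (p * MvPolynomial.X i) = π (yv F i) * ψ p := by rw [mul_comm, map_mul, hψ]
      rw [h5, map_mul, map_mul, Module.End.mul_apply, h3, hp, mul_assoc]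
  have hodd : ∀ g, ∃ a, IsOddFA F a ∧ π a = asmR π ev g := by
    intro g
    induction g using Finsupp.induction_linear with
    | zero => exact ⟨0, by simp [IsOddFA], by simp⟩
    | add f g hf hg =>
      obtain ⟨a, ha, ha'⟩ := hf
      obtain ⟨b, hb, hb'⟩ := hg
      refine ⟨a + b, ?_, by rw [map_add, map_add, ha', hb']⟩
      unfold IsOddFA at *; rw [map_add, ha, hb, neg_add]
    | single j q =>
      rw [asmR, asm_single]
      exact odd_mem_ev π ev hev1 hev2 q _ ⟨zv F j, by simp [IsOddFA, omegaFA, zv], rfl⟩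
  induction f using FreeAlgebra.induction with
  | grade0 r =>
    refine ⟨MvPolynomial.C r, 0, ?_, ?_, ?_⟩
    · rw [AlgHom.commutes, map_zero, add_zero]; exact (ψ.commutes r).symm
    · simp
    · intro t s c φ _ _
      rw [AlgHom.commutes, map_zero, map_zero, mul_zero, add_zero]
      exact (((aeval D).comp (evP t s)).commutes r).symm
  | grade1 x =>
    rcases x with i | j
    · refine ⟨MvPolynomial.X i, 0, ?_, ?_, ?_⟩
      · rw [hψ, map_zero, add_zero]; rfl
      · simp [constTerm]
      · intro t s c φ hy _
        rw [map_zero, map_zero, mul_zero, add_zero]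
        simpa [evP, yv] using hy i
    · refine ⟨0, Finsupp.single j 1, ?_, ?_, ?_⟩
      · rw [asmR, asm_single]; simp; rfl
      · simp [constTerm]
      · intro t s c φ _ hz
        rw [asmX, asm_single]
        simpa [zv] using hz j
  | add a b ha hb =>
    obtain ⟨p, g, h3, h4, h5⟩ := ha
    obtain ⟨p', g', h3', h4', h5'⟩ := hb
    refine ⟨p + p', g + g', ?_, ?_, ?_⟩
    · simp only [map_add, h3, h3']; abel
    · simp only [map_add, h4, h4']
    · intro t s c φ hy hz
      simp only [map_add, h5 t s c φ hy hz, h5' t s c φ hy hz, mul_add]; abel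
  | mul a b ha hb =>
    obtain ⟨p, g, h3, h4, h5⟩ := ha
    obtain ⟨p', g', h3', h4', h5'⟩ := hb
    refine ⟨p * p', lamQ F p • g' + rhoQ F p' • g, ?_, ?_, ?_⟩
    · obtain ⟨a1, ha1, ha1'⟩ := hodd g
      obtain ⟨b1, hb1, hb1'⟩ := hodd g'
      have h0 := h2 a1 b1 ha1 hb1
      rw [ha1', hb1'] at h0
      rw [map_mul, h3, h3', map_mul, map_add, asmR_smul, asmR_smul, hlam, hrho, add_mul, mul_add,
        mul_add, h0]
      abel
    · simp only [map_mul, h4, h4']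
    · intro t s c φ hy hz
      rw [map_mul, h5 t s c φ hy hz, h5' t s c φ hy hz, N_mul hDe hee, map_mul (evP t s), map_add (asmX t s c),
        asmX_smul, asmX_smul, evQ_rho, evQ_lam, Polynomial.smul_eq_C_mul, mul_comm (evP t s p')]

theorem lnc_ev {F R : Type} [Field F] [Ring R] [Algebra F R] (π : FA F →ₐ[F] R)
    (ev : MvPolynomial (ℕ ⊕ ℕ) F →ₐ[F] Module.End F R)
    (hev2 : ∀ i x, ev (MvPolynomial.X (Sum.inr i)) x = x * π (yv F i) - π (yv F i) * x)
    (l : List ℕ) (x : R) :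
    ev (l.map (fun i => MvPolynomial.X (Sum.inr i))).prod x = lnc x (l.map fun i => π (yv F i)) := by
  induction l generalizing x with
  | nil => simp [lnc]
  | cons i l ih =>
    rw [List.map_cons, List.prod_cons, mul_comm, map_mul, Module.End.mul_apply, ih, hev2]
    rfl

theorem hard {F R B : Type} [Field F] [CharZero F] [Ring R] [Algebra F R] [Ring B] [Algebra F B]
    (π : FA F →ₐ[F] R) (n : ℕ)
    (h1 : ∀ i j, π (yv F i) * π (yv F j) = π (yv F j) * π (yv F i))
    (h2 : ∀ a b, IsOddFA F a → IsOddFA F b → π a * π b = 0)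
    (h3 : ∀ j (l : List ℕ), l.length = n → lnc (π (zv F j)) (l.map fun i => π (yv F i)) = 0)
    {D e : B} (hDe : D * e = 0) (hee : e * e = 0)
    (f : FA F) (hf0 : constTerm F f = 0)
    (hp : ∀ p : F[X], e * aeval D p = p.coeff 0 • e → p.coeff 1 = 0)
    (hq : ∀ q : F[X], e * aeval D (q * X) = 0 → ∀ m < n, q.coeff m = 0)
    (hf : ∀ (t s c : ℕ → F) (φ : FA F →ₐ[F] B),
        (∀ i, φ (yv F i) = aeval D (C (t i) + C (s i) * X)) →
        (∀ j, φ (zv F j) = c j • e) → φ f * e = e * φ f ∧ φ f * D = D * φ f) : π f = 0 := by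
  obtain ⟨ψ, hψ⟩ := exists_ev (F := F) (fun i => π (yv F i)) h1
  obtain ⟨ev, hev⟩ := exists_ev (F := F) (A := Module.End F R)
    (Sum.elim (fun i => LinearMap.mulLeft F (π (yv F i)))
      (fun i => LinearMap.mulRight F (π (yv F i)) - LinearMap.mulLeft F (π (yv F i)))) (by
      have hL : ∀ i j (x : R), π (yv F i) * (π (yv F j) * x) = π (yv F j) * (π (yv F i) * x) := by
        intro i j x; rw [← mul_assoc, h1, mul_assoc]
      rintro (i | i) (j | j) <;> ext x <;>
        simp [mul_assoc, mul_sub, sub_mul, hL i j, h1 i j] <;> abel)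
  have hev1 : ∀ i x, ev (MvPolynomial.X (Sum.inl i)) x = π (yv F i) * x := by
    intro i x; rw [hev]; rfl
  have hev2 : ∀ i x, ev (MvPolynomial.X (Sum.inr i)) x = x * π (yv F i) - π (yv F i) * x := by
    intro i x; rw [hev]; rfl
  obtain ⟨p, g, hr, hc, hv⟩ := main_rep π h2 ψ hψ ev hev1 hev2 hDe hee f
  have hval : ∀ t s c : ℕ → F, (evP t s p).coeff 1 = 0 ∧ ∀ m < n, (asmX t s c g).coeff m = 0 := by
    intro t s c
    let φ : FA F →ₐ[F] B := FreeAlgebra.lift F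
      (Sum.elim (fun i => aeval D (C (t i) + C (s i) * X)) (fun j => c j • e))
    have hφy : ∀ i, φ (yv F i) = aeval D (C (t i) + C (s i) * X) := by intro i; simp [φ, yv]
    have hφz : ∀ j, φ (zv F j) = c j • e := by intro i; simp [φ, zv]
    obtain ⟨ha, hb⟩ := hf t s c φ hφy hφz
    rw [hv t s c φ hφy hφz] at ha hb
    constructor
    · apply hp
      rw [add_mul, aeval_mul_e hDe, e_aeval_e hDe hee, add_zero, mul_add, ← mul_assoc e e, hee,
        zero_mul, add_zero] at ha
      exact ha.symm
    · apply hq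
      have : D * aeval D (evP t s p) = aeval D (evP t s p) * D := by
        have := congrArg (aeval D) (mul_comm X (evP t s p))
        simpa using this
      rw [add_mul, mul_add, this, ← mul_assoc D e, hDe, zero_mul, add_right_inj] at hb
      rw [map_mul, aeval_X, ← mul_assoc, hb]
  have hp0 : p = 0 := by
    have := const_of p (fun t s => (hval t s 0).1)
    rw [← hc, hf0, map_zero] at this
    exact this
  have hg : ∀ j (d : ℕ ⊕ ℕ →₀ ℕ), Finsupp.weight wt2 d < n → MvPolynomial.coeff d (g j) = 0 := by
    intro j
    apply coeff_zero_of
    intro t s m hm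
    have := (hval t s (Pi.single j 1)).2 m hm
    have h5 : asmX t s (Pi.single j 1) g = evQ t s (g j) := by
      clear this
      clear hr hv hval
      induction g using Finsupp.induction_linear with
      | zero => simp
      | add f g hf hg => rw [map_add, hf, hg, Finsupp.add_apply, map_add]
      | single i q =>
        rw [asmX, asm_single]
        by_cases hij : i = j
        · subst hij; simp
        · simp [hij]
    rw [h5] at this
    exact this
  rw [hr, hp0, map_zero, zero_add, asmR, asm, Finsupp.lsum_apply]
  apply Finset.sum_eq_zero
  intro j _
  show ev (g j) (π (zv F j)) = 0
  rw [(g j).as_sum, map_sum, LinearMap.sum_apply]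
  apply Finset.sum_eq_zero
  intro d hd
  have hw : n ≤ Finsupp.weight wt2 d := by
    by_contra! hlt
    exact (MvPolynomial.mem_support_iff.mp hd) (hg j d hlt)
  obtain ⟨l, d', hl, he⟩ := monomial_split (F := F) n d hw
  have : MvPolynomial.monomial d (MvPolynomial.coeff d (g j)) =
      MvPolynomial.coeff d (g j) • MvPolynomial.monomial d (1 : F) := by
    rw [MvPolynomial.smul_monomial, smul_eq_mul, mul_one]
  rw [this, he, map_smul, map_mul, LinearMap.smul_apply, Module.End.mul_apply, lnc_ev π ev hev2,
    h3 j l hl, map_zero, smul_zero]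


theorem map_lnc {F A R : Type} [Field F] [Ring A] [Algebra F A] [Ring R] [Algebra F R]
    (φ : A →ₐ[F] R) (x : A) (l : List A) : φ (lnc x l) = lnc (φ x) (l.map φ) := by
  induction l generalizing x with
  | nil => rfl
  | cons a l ih =>
    show φ (lnc (brk x a) l) = lnc (brk (φ x) (φ a)) (l.map φ)
    rw [ih]
    simp [brk]

/-- substitutions of the shape `y ↦ p(D)`, `z ↦ e q(D)` -/
def GoodS {F B : Type} [Field F] [Ring B] [Algebra F B] (D e : B) (φ : FA F →ₐ[F] B) : Prop :=
  (∀ i, ∃ p : F[X], φ (yv F i) = aeval D p) ∧ (∀ j, ∃ q : F[X], φ (zv F j) = e * aeval D q)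

theorem val_form {F B : Type} [Field F] [Ring B] [Algebra F B] {D e : B} (hDe : D * e = 0)
    (hee : e * e = 0) (φ : FA F →ₐ[F] B) (hφ : GoodS D e φ) (f : FA F) :
    ∃ p q : F[X], φ f = aeval D p + e * aeval D q ∧
      φ (omegaFA F f) = aeval D p + e * aeval D (-q) := by
  induction f using FreeAlgebra.induction with
  | grade0 r => exact ⟨C r, 0, by simp, by simp⟩
  | grade1 x =>
    rcases x with i | j
    · obtain ⟨p, hp⟩ := hφ.1 i
      refine ⟨p, 0, ?_, ?_⟩
      · simpa [yv] using hp
      · simpa [yv, omegaFA] using hp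
    · obtain ⟨q, hq⟩ := hφ.2 j
      refine ⟨0, q, ?_, ?_⟩
      · simpa [zv] using hq
      · simpa [zv, omegaFA] using hq
  | add a b ha hb =>
    obtain ⟨p, q, h1, h2⟩ := ha
    obtain ⟨p', q', h1', h2'⟩ := hb
    refine ⟨p + p', q + q', ?_, ?_⟩
    · simp only [map_add, h1, h1', mul_add]; abel
    · simp only [map_add, h2, h2', mul_add, neg_add]; abel
  | mul a b ha hb =>
    obtain ⟨p, q, h1, h2⟩ := ha
    obtain ⟨p', q', h1', h2'⟩ := hb
    refine ⟨p * p', p.coeff 0 • q' + q * p', ?_, ?_⟩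
    · rw [map_mul, h1, h1', N_mul hDe hee]
    · rw [map_mul, map_mul, h2, h2', N_mul hDe hee]
      simp [add_comm]

/-- polynomials whose values are multiples of `e D^n` -/
def Ival {F B : Type} [Field F] [Ring B] [Algebra F B] (D e : B) (n : ℕ) :
    Submodule F (FA F) where
  carrier := {f | ∀ φ : FA F →ₐ[F] B, GoodS D e φ → ∃ c : F, φ f = c • (e * D ^ n)}
  add_mem' := by
    intro f g hf hg φ hφ
    obtain ⟨a, ha⟩ := hf φ hφ
    obtain ⟨b, hb⟩ := hg φ hφ
    exact ⟨a + b, by rw [map_add, ha, hb, add_smul]⟩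
  zero_mem' := fun φ _ => ⟨0, by simp⟩
  smul_mem' := by
    intro c f hf φ hφ
    obtain ⟨a, ha⟩ := hf φ hφ
    exact ⟨c * a, by rw [map_smul, ha, mul_smul]⟩

theorem left_mul_top {F B : Type} [Field F] [Ring B] [Algebra F B] {D e : B} (hDe : D * e = 0)
    (hee : e * e = 0) {n : ℕ} (p q : F[X]) :
    (aeval D p + e * aeval D q) * (e * D ^ n) = p.coeff 0 • (e * D ^ n) := by
  rw [add_mul, ← mul_assoc, ← mul_assoc, aeval_mul_e hDe, e_aeval_e hDe hee, zero_mul, add_zero,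
    smul_mul_assoc]

theorem right_mul_top {F B : Type} [Field F] [Ring B] [Algebra F B] {D e : B} (hDe : D * e = 0)
    (hee : e * e = 0) {n : ℕ} (hn : e * D ^ (n + 1) = 0) (p q : F[X]) :
    (e * D ^ n) * (aeval D p + e * aeval D q) = p.coeff 0 • (e * D ^ n) := by
  have h1 : e * D ^ n * e = 0 := by
    have := e_aeval_e (F := F) hDe hee (X ^ n)
    simpa using this
  have h2 := e_top hn p
  rw [mul_add, ← mul_assoc (e * D ^ n), h1, zero_mul, add_zero, ← h2]
  simp [mul_assoc]

theorem Ival_T2 {F B : Type} [Field F] [CharZero F] [Ring B] [Algebra F B] {D e : B}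
    (hDe : D * e = 0)
    (hee : e * e = 0) {n : ℕ} (hn : e * D ^ (n + 1) = 0) : IsT2Ideal F (Ival (F := F) D e n) := by
  have two : ∀ x : B, x + x = 0 → x = 0 := by
    intro x hx
    rw [← two_smul F] at hx
    exact (smul_eq_zero.mp hx).resolve_left two_ne_zero
  refine ⟨fun f hf g => ⟨fun φ hφ => ?_, fun φ hφ => ?_⟩, fun η hη f hf φ hφ => ?_⟩
  · obtain ⟨c, hc⟩ := hf φ hφ
    obtain ⟨p, q, h, -⟩ := val_form hDe hee φ hφ g
    exact ⟨c * p.coeff 0, by rw [map_mul, hc, h, mul_smul_comm, left_mul_top hDe hee, mul_smul]⟩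
  · obtain ⟨c, hc⟩ := hf φ hφ
    obtain ⟨p, q, h, -⟩ := val_form hDe hee φ hφ g
    exact ⟨c * p.coeff 0, by rw [map_mul, hc, h, smul_mul_assoc, right_mul_top hDe hee hn, mul_smul]⟩
  · refine hf (φ.comp η) ⟨fun i => ?_, fun j => ?_⟩
    · obtain ⟨p, q, h, h'⟩ := val_form hDe hee φ hφ (η (yv F i))
      rw [hη.1 i, h] at h'
      refine ⟨p, ?_⟩
      have : e * aeval D q = 0 := by
        apply two
        rw [map_neg, mul_neg, add_right_inj] at h'
        nth_rewrite 1 [h']; simp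
      rw [AlgHom.comp_apply, h, this, add_zero]
    · obtain ⟨p, q, h, h'⟩ := val_form hDe hee φ hφ (η (zv F j))
      rw [hη.2 j, map_neg, h] at h'
      refine ⟨q, ?_⟩
      have : aeval D p = 0 := by
        apply two
        rw [map_neg, mul_neg, neg_add, add_left_inj] at h'
        nth_rewrite 1 [← h']; simp
      rw [AlgHom.comp_apply, h, this, zero_add]

theorem Ival_gens {F B : Type} [Field F] [Ring B] [Algebra F B] {D e : B} (hDe : D * e = 0)
    (hee : e * e = 0) {n : ℕ} (hn : e * D ^ (n + 1) = 0) :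
    { brk (yv F 0) (yv F 1), lnc (zv F 0) ((List.range n).map (yv F)), zv F 0 * zv F 1 } ⊆
      ((Ival (F := F) D e n : Submodule F (FA F)) : Set (FA F)) := by
  rintro f (rfl | rfl | rfl) φ hφ
  · obtain ⟨p, hp⟩ := hφ.1 0
    obtain ⟨q, hq⟩ := hφ.1 1
    refine ⟨0, ?_⟩
    rw [brk, map_sub, map_mul, map_mul, hp, hq, ← map_mul, ← map_mul, mul_comm, sub_self, zero_smul]
  · obtain ⟨q, hq⟩ := hφ.2 0
    obtain ⟨q', h⟩ := lnc_val (e := e) hDe (((List.range n).map (yv F)).map φ) (by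
      intro b hb
      simp only [List.mem_map] at hb
      obtain ⟨_, ⟨i, -, rfl⟩, rfl⟩ := hb
      exact hφ.1 i) 0 q
    refine ⟨q'.coeff 0, ?_⟩
    rw [map_lnc, hq, ← e_top hn]
    simpa using h
  · obtain ⟨p, hp⟩ := hφ.2 0
    obtain ⟨q, hq⟩ := hφ.2 1
    refine ⟨0, ?_⟩
    rw [map_mul, hp, hq, ← mul_assoc, e_aeval_e hDe hee, zero_mul, zero_smul]

theorem E_pow {B : Type} [Ring B] {D e : B} (hDe : D * e = 0) (hee : e * e = 0) (m : ℕ) :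
    (D + e) ^ (m + 1) = D ^ (m + 1) + e * D ^ m := by
  induction m with
  | zero => simp
  | succ m ih =>
    have h1 : e * D ^ m * e = 0 := by
      rcases m with _ | m
      · simpa using hee
      · rw [pow_succ, mul_assoc, mul_assoc, hDe, mul_zero, mul_zero]
    rw [pow_succ, ih, add_mul, mul_add, mul_add, h1, pow_succ D m, mul_assoc _ D e, hDe]
    simp [pow_succ, mul_assoc]

/-- the even shift matrix -/
def DMat (F : Type) [Field F] (k : ℕ) : Matrix (Fin k) (Fin k) F := EMat F k - eMat F k 0 1

theorem DMat_apply {F : Type} [Field F] (k : ℕ) (a b : Fin k) :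
    DMat F k a b = if (a : ℕ) + 1 = b ∧ (a : ℕ) ≠ 0 then 1 else 0 := by
  simp only [DMat, EMat, eMat, Matrix.sub_apply, Matrix.of_apply]
  split_ifs <;> first | (exfalso; omega) | simp

theorem D_e {F : Type} [Field F] (k : ℕ) : DMat F k * eMat F k 0 1 = 0 := by
  ext a b
  rw [Matrix.mul_apply]
  apply Finset.sum_eq_zero
  intro l _
  rw [DMat_apply]
  simp only [eMat, Matrix.of_apply]
  split_ifs <;> first | (exfalso; omega) | simp

theorem e_e {F : Type} [Field F] (k : ℕ) : eMat F k 0 1 * eMat F k 0 1 = 0 := by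
  ext a b
  rw [Matrix.mul_apply]
  apply Finset.sum_eq_zero
  intro l _
  simp only [eMat, Matrix.of_apply]
  split_ifs <;> first | (exfalso; omega) | simp

theorem e_D_pow {F : Type} [Field F] (k m : ℕ) :
    eMat F k 0 1 * DMat F k ^ m = eMat F k 0 (m + 1) := by
  induction m with
  | zero => simp
  | succ m ih =>
    rw [pow_succ, ← mul_assoc, ih]
    ext a b
    rw [Matrix.mul_apply]
    by_cases hb : m + 1 < k
    · rw [Finset.sum_eq_single (⟨m + 1, hb⟩ : Fin k)]
      · rw [DMat_apply]
        simp only [eMat, Matrix.of_apply, and_true]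
        split_ifs <;> first | (exfalso; omega) | simp
      · intro l _ hl
        have : (l : ℕ) ≠ m + 1 := fun h => hl (Fin.ext h)
        simp [eMat, this]
      · simp
    · rw [Finset.sum_eq_zero]
      · have : (b : ℕ) ≠ m + 1 + 1 := by omega
        simp [eMat, this]
      · intro l _
        have : (l : ℕ) ≠ m + 1 := by omega
        simp [eMat, this]

theorem e_aeval_apply {F : Type} [Field F] (k : ℕ) (q : F[X]) (a : Fin k) (b : Fin k)
    (ha : (a : ℕ) = 0) (m : ℕ) (hb : (b : ℕ) = m + 1) :
    (eMat F k 0 1 * aeval (DMat F k) q) a b = q.coeff m := by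
  induction q using Polynomial.induction_on' with
  | add p q hp hq => rw [map_add, mul_add, Matrix.add_apply, hp, hq, coeff_add]
  | monomial n c =>
    rw [aeval_monomial, ← Algebra.smul_def, mul_smul_comm, e_D_pow, coeff_monomial]
    simp [eMat, ha, hb, eq_comm]

theorem D_even {F : Type} [Field F] (k : ℕ) (p : F[X]) :
    aeval (DMat F k) p ∈ matEvenPart F k := by
  have hpow : ∀ m, DMat F k ^ m ∈ matEvenPart F k := by
    intro m
    induction m with
    | zero =>
      intro i j h
      rw [pow_zero, Matrix.one_apply_ne]
      rintro rfl
      tauto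
    | succ m ih =>
      intro i j h
      rw [pow_succ, Matrix.mul_apply]
      apply Finset.sum_eq_zero
      intro l _
      by_cases h1 : ((i : ℕ) = 0) ↔ ¬ ((l : ℕ) = 0)
      · rw [ih i l h1, zero_mul]
      · rw [DMat_apply, if_neg, mul_zero]
        omega
  induction p using Polynomial.induction_on' with
  | add p q hp hq => rw [map_add]; exact Submodule.add_mem _ hp hq
  | monomial n c =>
    rw [aeval_monomial, ← Algebra.smul_def]
    exact Submodule.smul_mem _ _ (hpow n)

theorem eMat_odd {F : Type} [Field F] (k m : ℕ) : eMat F k 0 (m + 1) ∈ matOddPart F k := by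
  intro i j h
  simp only [eMat, Matrix.of_apply]
  rw [if_neg]
  omega

theorem e_odd {F : Type} [Field F] (k : ℕ) (p : F[X]) :
    eMat F k 0 1 * aeval (DMat F k) p ∈ matOddPart F k := by
  induction p using Polynomial.induction_on' with
  | add p q hp hq => rw [map_add, mul_add]; exact Submodule.add_mem _ hp hq
  | monomial n c =>
    rw [aeval_monomial, ← Algebra.smul_def, mul_smul_comm, e_D_pow]
    exact Submodule.smul_mem _ _ (eMat_odd k n)

theorem even_odd_zero {F : Type} [Field F] (k : ℕ) (x : Matrix (Fin k) (Fin k) F)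
    (h0 : x ∈ matEvenPart F k) (h1 : x ∈ matOddPart F k) : x = 0 := by
  ext i j
  by_cases h : ((i : ℕ) = 0) ↔ ((j : ℕ) = 0)
  · exact h1 i j h
  · exact h0 i j (by tauto)

theorem Nk_form {F : Type} [Field F] (k : ℕ) (x : Matrix (Fin k) (Fin k) F)
    (hx : x ∈ NkSub F k) :
    ∃ p q : F[X], x = aeval (DMat F k) p + eMat F k 0 1 * aeval (DMat F k) q := by
  unfold NkSub at hx
  induction hx using Submodule.span_induction with
  | mem x h =>
    rcases h with (h | ⟨m, h1, -, rfl⟩) | ⟨j, h1, -, rfl⟩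
    · rw [Set.mem_singleton_iff] at h
      exact ⟨1, 0, by simp [h]⟩
    · obtain ⟨m, rfl⟩ : ∃ m', m = m' + 1 := ⟨m - 1, by omega⟩
      refine ⟨X ^ (m + 1), X ^ m, ?_⟩
      have : EMat F k = DMat F k + eMat F k 0 1 := by simp [DMat]
      rw [this, E_pow (D_e k) (e_e k)]
      simp
    · obtain ⟨m, rfl⟩ : ∃ m', j = m' + 1 := ⟨j - 1, by omega⟩
      exact ⟨0, X ^ m, by simp [e_D_pow]⟩
  | zero => exact ⟨0, 0, by simp⟩
  | add x y _ _ hx hy =>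
    obtain ⟨p, q, rfl⟩ := hx
    obtain ⟨p', q', rfl⟩ := hy
    exact ⟨p + p', q + q', by simp only [map_add, mul_add]; abel⟩
  | smul c x _ hx =>
    obtain ⟨p, q, rfl⟩ := hx
    exact ⟨c • p, c • q, by simp only [map_smul, smul_add, mul_smul_comm]⟩

theorem good_of_gsubst {F : Type} [Field F] (k : ℕ) (φ : FA F →ₐ[F] Matrix (Fin k) (Fin k) F)
    (hφ : IsGSubst F _ (NkSub F k ⊓ matEvenPart F k) (NkSub F k ⊓ matOddPart F k) φ) :
    GoodS (DMat F k) (eMat F k 0 1) φ := by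
  refine ⟨fun i => ?_, fun j => ?_⟩
  · obtain ⟨h1, h2⟩ := hφ.1 i
    obtain ⟨p, q, h⟩ := Nk_form k _ h1
    refine ⟨p, ?_⟩
    rw [h] at h2 ⊢
    have h3 := (Submodule.add_mem_iff_right _ (D_even k p)).mp h2
    rw [even_odd_zero k _ h3 (e_odd k q), add_zero]
  · obtain ⟨h1, h2⟩ := hφ.2 j
    obtain ⟨p, q, h⟩ := Nk_form k _ h1
    refine ⟨q, ?_⟩
    rw [h] at h2 ⊢
    have h3 := (Submodule.add_mem_iff_left _ (e_odd k q)).mp h2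
    rw [even_odd_zero k _ (D_even k p) h3, zero_add]

theorem e_mem {F : Type} [Field F] (k m : ℕ) (hm : m + 1 ≤ k - 1) :
    eMat F k 0 (m + 1) ∈ NkSub F k ⊓ matOddPart F k :=
  ⟨Submodule.subset_span (Or.inr ⟨m + 1, by omega, hm, rfl⟩), eMat_odd k m⟩

theorem D_mem {F : Type} [Field F] (k : ℕ) (hk : 3 ≤ k) :
    DMat F k ∈ NkSub F k ⊓ matEvenPart F k := by
  refine ⟨?_, by simpa using D_even k (X : F[X])⟩
  refine Submodule.sub_mem _ (Submodule.subset_span (Or.inl (Or.inr ⟨1, le_rfl, by omega, ?_⟩)))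
    (e_mem k 0 (by omega)).1
  rw [pow_one]

theorem Ival_le {F : Type} [Field F] (k : ℕ) (hk : 3 ≤ k) :
    Ival (F := F) (DMat F k) (eMat F k 0 1) (k - 2) ≤ CGr F (Matrix (Fin k) (Fin k) F)
        (NkSub F k ⊓ matEvenPart F k) (NkSub F k ⊓ matOddPart F k) := by
  have hn : eMat F k 0 1 * DMat F k ^ (k - 2 + 1) = 0 := by
    rw [e_D_pow]
    ext a b
    have : (b : ℕ) ≠ k - 2 + 1 + 1 := by omega
    simp [eMat, this]
  intro f hf
  refine ⟨?_, fun φ hφ => ?_⟩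
  · let φ : FA F →ₐ[F] Matrix (Fin k) (Fin k) F := (Algebra.ofId F _).comp (constTerm F)
    obtain ⟨c, hc⟩ := hf φ ⟨fun i => ⟨0, by simp [φ, constTerm, yv]⟩,
      fun i => ⟨0, by simp [φ, constTerm, zv]⟩⟩
    have h2 := congrFun (congrFun hc ⟨0, by omega⟩) ⟨0, by omega⟩
    rw [e_D_pow] at h2
    simpa [φ, eMat, Algebra.ofId_apply, Matrix.algebraMap_matrix_apply] using h2
  · obtain ⟨c, hc⟩ := hf φ (good_of_gsubst k φ hφ)
    rw [hc]
    apply Submodule.smul_mem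
    refine ⟨?_, fun y hy => ?_⟩
    · rw [e_D_pow]
      exact Submodule.mem_sup_right (e_mem k (k - 2) (by omega))
    · have hy' : y ∈ NkSub F k := by
        obtain ⟨a, ha, b, hb, rfl⟩ := Submodule.mem_sup.mp hy
        exact Submodule.add_mem _ ha.1 hb.1
      obtain ⟨p, q, rfl⟩ := Nk_form k y hy'
      rw [left_mul_top (D_e k) (e_e k), right_mul_top (D_e k) (e_e k) hn]

theorem exists_quot {F : Type} [Field F] (I : Submodule F (FA F))
    (hI : ∀ f ∈ I, ∀ g : FA F, g * f ∈ I ∧ f * g ∈ I) :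
    ∃ (R : Type) (_ : Ring R) (_ : Algebra F R) (π : FA F →ₐ[F] R), ∀ f, π f = 0 ↔ f ∈ I := by
  let J : TwoSidedIdeal (FA F) := TwoSidedIdeal.mk' (I : Set (FA F)) I.zero_mem I.add_mem I.neg_mem
    (fun {x y} h => (hI y h x).1) (fun {x y} h => (hI x h y).2)
  refine ⟨J.ringCon.Quotient, inferInstance, inferInstance,
    { J.ringCon.mk' with commutes' := fun r => rfl }, fun f => ?_⟩
  have h1 : f ∈ J ↔ f ∈ I := TwoSidedIdeal.mem_mk' _ _ _ _ _ _ _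
  rw [← h1]
  conv_rhs => rw [← TwoSidedIdeal.ker_ringCon_mk' J, TwoSidedIdeal.mem_ker]
  rfl

end Helper

/-- for `k ≥ 3`, `C^gr(N_k^{gr})` is the T₂-ideal generated by
`[y₁,y₂]`, `[z₁,y₁,…,y_{k-2}]` and `z₁z₂`. -/
theorem stmt10 (F : Type) [Field F] [CharZero F] (k : ℕ) (hk : 3 ≤ k) :
    CGr F (Matrix (Fin k) (Fin k) F)
        (NkSub F k ⊓ matEvenPart F k) (NkSub F k ⊓ matOddPart F k) =
      T2IdealGen F
        { brk (yv F 0) (yv F 1),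
          lnc (zv F 0) ((List.range (k - 2)).map (yv F)),
          zv F 0 * zv F 1 } := by
  have hn : eMat F k 0 1 * DMat F k ^ (k - 2 + 1) = 0 := by
    rw [e_D_pow]
    ext a b
    have : (b : ℕ) ≠ k - 2 + 1 + 1 := by omega
    simp [eMat, this]
  apply le_antisymm
  · refine le_sInf ?_
    rintro I ⟨hS, hI, hT⟩ f ⟨hf0, hf⟩
    obtain ⟨R, _, _, π, hπ⟩ := exists_quot I hI
    have ey : ∀ i, IsEvenFA F (yv F i) := by intro i; simp [IsEvenFA, omegaFA, yv]
    have oz : ∀ i, IsOddFA F (zv F i) := by intro i; simp [IsOddFA, omegaFA, zv]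
    -- endomorphisms
    have hsub : ∀ (a b : ℕ → FA F), (∀ i, IsEvenFA F (a i)) → (∀ i, IsOddFA F (b i)) →
        ∃ η : FA F →ₐ[F] FA F, IsT2Endo F η ∧ (∀ i, η (yv F i) = a i) ∧ (∀ i, η (zv F i) = b i) := by
      intro a b ha hb
      have h1 : ∀ i, FreeAlgebra.lift F (Sum.elim a b) (yv F i) = a i := by intro i; simp [yv]
      have h2 : ∀ i, FreeAlgebra.lift F (Sum.elim a b) (zv F i) = b i := by intro i; simp [zv]
      refine ⟨FreeAlgebra.lift F (Sum.elim a b), ⟨fun i => ?_, fun i => ?_⟩, h1, h2⟩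
      · rw [h1]; exact ha i
      · rw [h2]; exact hb i
    rw [← hπ]
    refine hard π (k - 2) ?_ ?_ ?_ (D_e (F := F) k) (e_e k) f hf0 ?_ ?_ ?_
    · intro i j
      obtain ⟨η, hη, hy, hz⟩ := hsub (fun m => if m = 0 then yv F i else yv F j) (fun m => zv F m)
        (by intro m; split_ifs <;> exact ey _) oz
      have h := (hπ _).mpr (hT η hη _ (hS (Or.inl rfl)))
      simpa [brk, hy, sub_eq_zero] using h
    · intro a b ha hb
      obtain ⟨η, hη, hy, hz⟩ := hsub (yv F) (fun m => if m = 0 then a else b)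
        ey (by intro m; split_ifs <;> assumption)
      have h := (hπ _).mpr (hT η hη _ (hS (Or.inr (Or.inr rfl))))
      simpa [hz] using h
    · intro j l hl
      obtain ⟨η, hη, hy, hz⟩ := hsub (fun m => yv F (l.getD m 0)) (fun _ => zv F j)
        (fun _ => ey _) (fun _ => oz _)
      have h := (hπ _).mpr (hT η hη _ (hS (Or.inr (Or.inl rfl))))
      rw [map_lnc, map_lnc, hz] at h
      rw [← h]
      congr 1
      apply List.ext_getElem
      · simp [hl]
      · intro i h1 h2
        have : i < l.length := by simpa using h1
        simp [hy, this]
    · intro p hp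
      have h := congrFun (congrFun hp ⟨0, by omega⟩) ⟨2, by omega⟩
      rw [e_aeval_apply k p _ _ rfl 1 rfl] at h
      rw [h]
      simp [eMat]
    · intro q hq m hm
      have h := congrFun (congrFun hq ⟨0, by omega⟩) ⟨m + 2, by omega⟩
      rw [e_aeval_apply k _ _ _ rfl (m + 1) rfl, Polynomial.coeff_mul_X] at h
      simpa using h
    · intro t s c φ hy hz
      have he : eMat F k 0 1 ∈ NkSub F k ⊓ matOddPart F k := e_mem k 0 (by omega)
      have h1 : (1 : Matrix (Fin k) (Fin k) F) ∈ NkSub F k ⊓ matEvenPart F k :=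
        ⟨Submodule.subset_span (Or.inl (Or.inl rfl)), by simpa using D_even k (1 : Polynomial F)⟩
      obtain ⟨-, hc⟩ := hf φ ⟨fun i => by
        rw [hy i]
        simp only [map_add, map_mul, Polynomial.aeval_C, Polynomial.aeval_X,
          Algebra.algebraMap_eq_smul_one]
        rw [smul_mul_assoc, one_mul]
        exact Submodule.add_mem _ (Submodule.smul_mem _ _ h1)
          (Submodule.smul_mem _ _ (D_mem k hk)), fun j => by
        rw [hz j]; exact Submodule.smul_mem _ _ he⟩
      exact ⟨hc _ (Submodule.mem_sup_right he), hc _ (Submodule.mem_sup_left (D_mem k hk))⟩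
  · refine le_trans (sInf_le ⟨Ival_gens (D_e k) (e_e k) hn, Ival_T2 (D_e k) (e_e k) hn⟩)
      (Ival_le k hk)
end

section
/- For every k ≥ 1 and every n ≥ 1, the finite-dimensional Grassmann algebra G_{2k} on 2k generators, regarded as a superalgebra with the trivial grading, satisfies c_n^{gr,z}(G_{2k}) = Σ_{i=0}^{k−1} C(n−1, 2i) and δ_n^{gr}(G_{2k}) = C(n, 2k) + Σ_{i=0}^{k−2} C(n−1, 2i+1). -/
/-! ### Signs of words -/

/-- sign of a word: `(-1)` to the number of inversions -/
def lsg (F : Type) [Field F] {n : ℕ} : List (Fin n) → F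
  | [] => 1
  | a :: l => (-1) ^ (l.countP (fun b => decide (b < a))) * lsg F l

theorem lsg_ne_zero (F : Type) [Field F] {n : ℕ} (l : List (Fin n)) : lsg F l ≠ 0 := by
  induction l with
  | nil => simp [lsg]
  | cons a l ih => simp [lsg, ih]

theorem lsg_swap (F : Type) [Field F] {n : ℕ} (u v : List (Fin n)) (a b : Fin n) (hab : a ≠ b) :
    lsg F (u ++ a :: b :: v) = - lsg F (u ++ b :: a :: v) := by
  induction u with
  | nil =>
    rcases lt_or_gt_of_ne hab with h | h
    · simp [lsg, List.countP_cons, h, h.le, pow_succ]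
      ring
    · simp [lsg, List.countP_cons, h, h.le, pow_succ]
      ring
  | cons c u ih =>
    have : List.countP (fun x => decide (x < c)) (u ++ a :: b :: v)
        = List.countP (fun x => decide (x < c)) (u ++ b :: a :: v) := by
      simp [List.countP_append, List.countP_cons]; omega
    simp only [List.cons_append, lsg, ih, this]
    ring

theorem lsg_move (F : Type) [Field F] {n : ℕ} (u v : List (Fin n)) (a : Fin n) (ha : a ∉ u) :
    lsg F (a :: (u ++ v)) = (-1) ^ u.length * lsg F (u ++ a :: v) := by
  induction u using List.reverseRecOn generalizing v with
  | nil => simp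
  | append_singleton u b ih =>
    simp only [List.mem_append, List.mem_singleton, not_or] at ha
    have h1 := ih (b :: v) ha.1
    have h2 := lsg_swap F u v a b ha.2
    simp only [List.append_assoc, List.cons_append, List.nil_append, List.length_append,
      List.length_cons, List.length_nil] at *
    rw [h1, h2]
    ring

theorem lsg_erase (F : Type) [Field F] {n : ℕ} (l : List (Fin n)) (hl : l.Nodup) (a : Fin n)
    (ha : a ∈ l) :
    (-1) ^ (l.countP (fun b => decide (b < a))) * lsg F (l.erase a)
      = (-1) ^ (l.idxOf a) * lsg F l := by
  obtain ⟨u, v, rfl⟩ := List.append_of_mem ha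
  have hau : a ∉ u := fun h => (List.disjoint_of_nodup_append hl) h (by simp)
  have hm := lsg_move F u v a hau
  rw [List.erase_append_right _ hau, List.erase_cons_head, List.idxOf_append_of_notMem hau]
  simp only [List.idxOf_cons_self, add_zero]
  rw [← hm]
  simp [lsg, List.countP_append, List.countP_cons]

theorem idx_sum (F : Type) [Field F] {n : ℕ} (l : List (Fin n)) (hl : l.Nodup) :
    (l.map (fun a => (-1 : F) ^ (l.idxOf a))).sum = if Even l.length then 0 else 1 := by
  induction l with
  | nil => simp
  | cons a l ih =>
    have h := ih hl.of_cons
    have ha : a ∉ l := (List.nodup_cons.1 hl).1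
    have : l.map (fun b => (-1 : F) ^ ((a :: l).idxOf b))
        = l.map (fun b => (-1) * (-1 : F) ^ (l.idxOf b)) := by
      apply List.map_congr_left
      intro b hb
      rw [List.idxOf_cons_ne _ (by rintro rfl; exact ha hb), pow_succ']
    rw [List.map_cons, List.sum_cons, this, List.sum_map_mul_left, h]
    simp only [List.idxOf_cons_self, pow_zero, List.length_cons, Nat.even_add_one]
    by_cases h : Even l.length <;> simp [h]

/-- sign of the restriction of the word `l` to the letters in `S` -/
def psg (F : Type) [Field F] {n : ℕ} (S : Finset (Fin n)) (l : List (Fin n)) : F :=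
  lsg F (l.filter (fun i => decide (i ∈ S)))

/-- the boundary relation -/
theorem psg_rel (F : Type) [Field F] {n : ℕ} (S : Finset (Fin n)) (l : List (Fin n))
    (hl : l.Nodup) (hall : ∀ i, i ∈ l) :
    ∑ j ∈ S, (-1 : F) ^ (S.filter (fun b => b < j)).card * psg F (S.erase j) l
      = (if Even S.card then 0 else 1) * psg F S l := by
  set q := l.filter (fun i => decide (i ∈ S)) with hq
  have hqn : q.Nodup := hl.filter _
  have hqS : q.toFinset = S := by ext i; simp [hq, hall]
  have hlen : q.length = S.card := by rw [← hqS, List.toFinset_card_of_nodup hqn]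
  have key : ∀ j ∈ S, (-1 : F) ^ (S.filter (fun b => b < j)).card * psg F (S.erase j) l
      = (-1) ^ (q.idxOf j) * lsg F q := by
    intro j hj
    have hjq : j ∈ q := by rw [← List.mem_toFinset, hqS]; exact hj
    rw [← lsg_erase F q hqn j hjq]
    have e1 : (S.filter (fun b => b < j)).card = q.countP (fun b => decide (b < j)) := by
      rw [List.countP_eq_length_filter, ← List.toFinset_card_of_nodup (hqn.filter _)]
      congr 1
      ext i; simp [hq, hall, and_comm]
    have e2 : l.filter (fun i => decide (i ∈ S.erase j)) = q.erase j := by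
      rw [hqn.erase_eq_filter, hq, List.filter_filter]
      apply List.filter_congr
      intro x _
      by_cases hx : x = j <;> simp [hx]
    rw [e1, psg, e2]
  rw [Finset.sum_congr rfl key, ← Finset.sum_mul]
  congr 1
  rw [← hlen, ← idx_sum F q hqn, ← List.sum_toFinset _ hqn, hqS]

/-- alternating sum over swaps of consecutive pairs in the second list -/
def dsw (F : Type) [Field F] {n : ℕ} (h : List (Fin n) → F) : List (Fin n) → List (Fin n) → F
  | u, [] => h u
  | u, [a] => h (u ++ [a])
  | u, a :: b :: l => dsw F h (u ++ [a, b]) l - dsw F h (u ++ [b, a]) l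

theorem dsw_zero (F : Type) [Field F] {n : ℕ} (h : List (Fin n) → F) (u s : List (Fin n))
    (H : ∀ l, l.Perm (u ++ s) → h l = 0) : dsw F h u s = 0 := by
  induction u, s using dsw.induct with
  | case1 u => simpa [dsw] using H u (by simp)
  | case2 u a => simpa [dsw] using H (u ++ [a]) (by simp)
  | case3 u a b l ih1 ih2 =>
    rw [dsw, ih1, ih2, sub_zero]
    · intro l' hl'
      refine H l' (hl'.trans ?_)
      simp only [List.append_assoc, List.cons_append, List.nil_append]
      exact List.Perm.append_left _ (List.Perm.swap _ _ _)
    · intro l' hl'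
      refine H l' (hl'.trans ?_)
      simp

theorem dsw_sum (F : Type) [Field F] {n : ℕ} {J : Type} (I : Finset J) (c : J → F)
    (h : J → List (Fin n) → F) (u s : List (Fin n)) :
    dsw F (fun l => ∑ j ∈ I, c j * h j l) u s = ∑ j ∈ I, c j * dsw F (h j) u s := by
  induction u, s using dsw.induct with
  | case1 u => simp [dsw]
  | case2 u a => simp [dsw]
  | case3 u a b l ih1 ih2 =>
    simp only [dsw, ih1, ih2, mul_sub, Finset.sum_sub_distrib]

theorem dsw_psg (F : Type) [Field F] {n : ℕ} (T : Finset (Fin n)) (u s : List (Fin n))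
    (hs : s.Nodup) (he : Even s.length) :
    dsw F (psg F T) u s = if (∀ a ∈ s, a ∈ T) then 2 ^ (s.length / 2) * psg F T (u ++ s) else 0 := by
  induction u, s using dsw.induct with
  | case1 u => simp [dsw]
  | case2 u a => simp at he
  | case3 u a b l ih1 ih2 =>
    have hl : l.Nodup := hs.of_cons.of_cons
    have hab : a ≠ b := by
      rintro rfl
      simp at hs
    have hel : Even l.length := by
      simp only [List.length_cons, Nat.even_add_one, not_not] at he
      exact he
    rw [dsw, ih1 hl hel, ih2 hl hel]
    have e3 : (a :: b :: l).length / 2 = l.length / 2 + 1 := by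
      simp only [List.length_cons]; omega
    rw [e3]
    by_cases hT : ∀ c ∈ l, c ∈ T
    · simp only [hT, List.mem_cons, forall_eq_or_imp]
      by_cases ha : a ∈ T <;> by_cases hb : b ∈ T
      · have := lsg_swap F (u.filter (fun i => decide (i ∈ T))) (l.filter (fun i => decide (i ∈ T))) a b hab
        simp [psg, ha, hb, List.filter_cons, this, pow_succ]
        simp only [if_pos hT]; ring
      all_goals simp [psg, ha, hb, List.filter_cons]
    · simp [hT]

/-- triangularity: linear independence of the sign functionals -/
theorem psg_indep (F : Type) [Field F] [CharZero F] {n : ℕ} (I : Finset (Finset (Fin n)))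
    (g : Finset (Fin n) → Finset (Fin n)) (heven : ∀ T ∈ I, Even T.card)
    (hsub : ∀ T ∈ I, T ⊆ g T) (htri : ∀ T ∈ I, ∀ T' ∈ I, T ⊆ g T' → T ⊆ T')
    (c : Finset (Fin n) → F)
    (H : ∀ l : List (Fin n), l.Nodup → (∀ i, i ∈ l) → ∑ T ∈ I, c T * psg F (g T) l = 0) :
    ∀ T ∈ I, c T = 0 := by
  classical
  by_contra hcon
  push Not at hcon
  obtain ⟨T0, hT0, hc0⟩ := hcon
  obtain ⟨T, hT⟩ := (I.filter (fun T => c T ≠ 0)).exists_maximal ⟨T0, by simp [hT0, hc0]⟩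
  have hTI : T ∈ I := (Finset.mem_filter.1 hT.1).1
  have hcT : c T ≠ 0 := (Finset.mem_filter.1 hT.1).2
  have hz : dsw F (fun l => ∑ T ∈ I, c T * psg F (g T) l) (Tᶜ).toList T.toList = 0 := by
    apply dsw_zero
    intro l hl
    apply H
    · rw [hl.nodup_iff, List.nodup_append]
      refine ⟨Finset.nodup_toList _, Finset.nodup_toList _, ?_⟩
      intro a ha b hb hab
      simp at ha hb
      exact ha (hab ▸ hb)
    · intro i
      rw [hl.mem_iff]
      simp only [List.mem_append, Finset.mem_toList, Finset.mem_compl]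
      tauto
  rw [dsw_sum, Finset.sum_eq_single T] at hz
  · rw [dsw_psg F _ _ _ (Finset.nodup_toList _) (by simpa using heven T hTI), if_pos] at hz
    · have := lsg_ne_zero F ((Tᶜ.toList ++ T.toList).filter (fun i => decide (i ∈ g T)))
      simp [psg, hcT] at hz
      simp at this
      exact this hz
    · intro a ha
      exact hsub T hTI (by simpa using ha)
  · intro T' hT' hne
    by_cases hc' : c T' = 0
    · simp [hc']
    rw [dsw_psg F _ _ _ (Finset.nodup_toList _) (by simpa using heven T hTI), if_neg, mul_zero]
    intro hh
    have hle := htri T hTI T' hT' (fun a ha => hh a (by simpa using ha))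
    exact hne (le_antisymm (hT.2 (by simp [hT', hc']) hle) hle)
  · intro h; exact absurd hTI h

/-! ### Sorting words in a supercommutative family -/

theorem psg_cons (F : Type) [Field F] {n : ℕ} (S : Finset (Fin n)) (a : Fin n)
    (l : List (Fin n)) :
    psg F S (a :: l) = (if a ∈ S then
      (-1 : F) ^ (l.countP (fun b => decide (b < a) && decide (b ∈ S))) else 1) * psg F S l := by
  by_cases ha : a ∈ S
  · simp [psg, ha, lsg, List.countP_filter]
  · simp [psg, ha]

theorem insert_prod (F : Type) [Field F] {A : Type} [Ring A] [Algebra F A] {n : ℕ}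
    (S : Finset (Fin n)) (x : Fin n → A)
    (hodd : ∀ i ∈ S, ∀ j ∈ S, x i * x j = -(x j * x i))
    (heven : ∀ i, i ∉ S → ∀ y, x i * y = y * x i) (a : Fin n) (s : List (Fin n))
    (hs : s.Pairwise (· ≤ ·)) :
    x a * (s.map x).prod = (if a ∈ S then
      (-1 : F) ^ (s.countP (fun b => decide (b < a) && decide (b ∈ S))) else 1) •
        ((s.orderedInsert (· ≤ ·) a).map x).prod := by
  induction s with
  | nil => simp
  | cons b s ih =>
    rw [List.pairwise_cons] at hs
    have ih := ih hs.2
    by_cases hab : a ≤ b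
    · have h0 : (b :: s).countP (fun b => decide (b < a) && decide (b ∈ S)) = 0 := by
        rw [List.countP_eq_zero]
        intro c hc
        have : a ≤ c := by
          rcases List.mem_cons.1 hc with rfl | hc
          · exact hab
          · exact hab.trans (hs.1 c hc)
        simp [this]
      rw [h0, List.orderedInsert_cons_of_le _ _ hab]
      simp
    · rw [List.orderedInsert_of_not_le _ _ hab]
      have hba : b < a := not_le.1 hab
      simp only [List.map_cons, List.prod_cons, List.countP_cons]
      by_cases ha : a ∈ S
      · by_cases hb : b ∈ S
        · rw [← mul_assoc, hodd a ha b hb, neg_mul, mul_assoc, ih]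
          simp [ha, hb, hba, pow_succ]
        · rw [← mul_assoc, ← heven b hb (x a), mul_assoc, ih]
          simp [ha, hb]
      · rw [← mul_assoc, heven a ha (x b), mul_assoc, ih]
        simp [ha]

theorem word_sort (F : Type) [Field F] {A : Type} [Ring A] [Algebra F A] {n : ℕ}
    (S : Finset (Fin n)) (x : Fin n → A)
    (hodd : ∀ i ∈ S, ∀ j ∈ S, x i * x j = -(x j * x i))
    (heven : ∀ i, i ∉ S → ∀ y, x i * y = y * x i) (l : List (Fin n)) :
    (l.map x).prod = psg F S l • ((l.insertionSort (· ≤ ·)).map x).prod := by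
  induction l with
  | nil => simp [psg, lsg]
  | cons a l ih =>
    rw [List.map_cons, List.prod_cons, ih, mul_smul_comm,
      insert_prod F S x hodd heven a _ (List.pairwise_insertionSort _ _), psg_cons,
      (List.perm_insertionSort (· ≤ ·) l).countP_eq, List.insertionSort_cons, smul_smul, mul_comm]

/-- the sorted full word -/
def fullW (n : ℕ) : List (Fin n) := (List.finRange n).insertionSort (· ≤ ·)

theorem sort_full {n : ℕ} (l : List (Fin n)) (hl : l.Nodup) (hall : ∀ i, i ∈ l) :
    l.insertionSort (· ≤ ·) = fullW n := by
  have hp : l.Perm (List.finRange n) :=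
    (List.perm_ext_iff_of_nodup hl (List.nodup_finRange n)).2 (by simp [hall])
  exact List.Perm.eq_of_pairwise' (List.pairwise_insertionSort _ _)
    (List.pairwise_insertionSort _ _)
    (((List.perm_insertionSort _ _).trans hp).trans (List.perm_insertionSort _ _).symm)

theorem fullW_nodup (n : ℕ) : (fullW n).Nodup :=
  (List.perm_insertionSort _ _).nodup_iff.2 (List.nodup_finRange n)

theorem mem_fullW {n : ℕ} (i : Fin n) : i ∈ fullW n :=
  (List.perm_insertionSort _ _).mem_iff.2 (by simp)

theorem fullW_filter_length {n : ℕ} (S : Finset (Fin n)) :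
    ((fullW n).filter (fun i => decide (i ∈ S))).length = S.card := by
  rw [← List.toFinset_card_of_nodup ((fullW_nodup n).filter _)]
  congr 1
  ext i; simp [mem_fullW]

/-! ### The Grassmann algebra -/

/-- span of products of at least `m` vectors, the number having the parity of `m` -/
def grD (F : Type) [Field F] (M : Type) [AddCommGroup M] [Module F M] (m : ℕ) :
    Submodule F (ExteriorAlgebra F M) :=
  Submodule.span F {x | ∃ l : List M, m ≤ l.length ∧ l.length % 2 = m % 2 ∧
    x = (l.map (ExteriorAlgebra.ι F)).prod}

section gr
variable {F : Type} [Field F] {M : Type} [AddCommGroup M] [Module F M]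

theorem grD_mul {a b : ℕ} {x y : ExteriorAlgebra F M} (hx : x ∈ grD F M a) (hy : y ∈ grD F M b) :
    x * y ∈ grD F M (a + b) := by
  have h : grD F M a * grD F M b ≤ grD F M (a + b) := by
    rw [grD, grD, Submodule.span_mul_span, Submodule.span_le]
    rintro _ ⟨_, ⟨l, h1, h2, rfl⟩, _, ⟨l', h1', h2', rfl⟩, rfl⟩
    refine Submodule.subset_span ⟨l ++ l', ?_, ?_, ?_⟩
    · simp; omega
    · simp; omega
    · simp
  exact h (Submodule.mul_mem_mul hx hy)

theorem grD_one : (1 : ExteriorAlgebra F M) ∈ grD F M 0 :=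
  Submodule.subset_span ⟨[], by simp⟩

theorem grD_mono {a b : ℕ} (h : b ≤ a) (h2 : a % 2 = b % 2) : grD F M a ≤ grD F M b := by
  apply Submodule.span_mono
  rintro _ ⟨l, h1, h3, rfl⟩
  exact ⟨l, h.trans h1, h3.trans h2, rfl⟩

theorem anti1 (a b : M) : ExteriorAlgebra.ι F a * ExteriorAlgebra.ι F b =
    -(ExteriorAlgebra.ι F b * ExteriorAlgebra.ι F a) :=
  eq_neg_of_add_eq_zero_left (ExteriorAlgebra.ι_add_mul_swap a b)

theorem anti2 (a : M) (l : List M) :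
    ExteriorAlgebra.ι F a * (l.map (ExteriorAlgebra.ι F)).prod =
    (-1 : F) ^ l.length • ((l.map (ExteriorAlgebra.ι F)).prod * ExteriorAlgebra.ι F a) := by
  induction l with
  | nil => simp
  | cons b l ih =>
    simp only [List.map_cons, List.prod_cons, List.length_cons]
    rw [← mul_assoc, anti1, neg_mul, mul_assoc, ih, pow_succ]
    simp [mul_assoc]

theorem anti3 (l l' : List M) :
    (l.map (ExteriorAlgebra.ι F)).prod * (l'.map (ExteriorAlgebra.ι F)).prod =
    (-1 : F) ^ (l.length * l'.length) • ((l'.map (ExteriorAlgebra.ι F)).prod *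
      (l.map (ExteriorAlgebra.ι F)).prod) := by
  induction l with
  | nil => simp
  | cons b l ih =>
    simp only [List.map_cons, List.prod_cons, List.length_cons]
    rw [mul_assoc, ih, mul_smul_comm, ← mul_assoc, anti2, smul_mul_assoc, smul_smul, ← pow_add,
      mul_assoc]
    congr 2
    ring

theorem grD_top (x : ExteriorAlgebra F M) : ∃ a ∈ grD F M 0, ∃ b ∈ grD F M 1, x = a + b := by
  have : x ∈ grD F M 0 ⊔ grD F M 1 := by
    induction x using ExteriorAlgebra.induction with
    | algebraMap r =>
      rw [Algebra.algebraMap_eq_smul_one]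
      exact Submodule.mem_sup_left (Submodule.smul_mem _ _ grD_one)
    | ι m => exact Submodule.mem_sup_right (Submodule.subset_span ⟨[m], by simp⟩)
    | mul a b ha hb =>
      obtain ⟨a0, h0, a1, h1, rfl⟩ := Submodule.mem_sup.1 ha
      obtain ⟨b0, k0, b1, k1, rfl⟩ := Submodule.mem_sup.1 hb
      have e : (a0 + a1) * (b0 + b1) = (a0 * b0 + a1 * b1) + (a0 * b1 + a1 * b0) := by
        noncomm_ring
      rw [e]
      have m1 : a0 * b0 ∈ grD F M 0 := by simpa only [Nat.add_zero] using grD_mul h0 k0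
      have m2 : a1 * b1 ∈ grD F M 0 :=
        grD_mono (a := 1 + 1) (b := 0) (Nat.zero_le _) rfl (grD_mul h1 k1)
      have m3 : a0 * b1 ∈ grD F M 1 := by simpa only [Nat.zero_add] using grD_mul h0 k1
      have m4 : a1 * b0 ∈ grD F M 1 := by simpa only [Nat.add_zero] using grD_mul h1 k0
      exact Submodule.add_mem_sup (Submodule.add_mem _ m1 m2) (Submodule.add_mem _ m3 m4)
    | add a b ha hb => exact Submodule.add_mem _ ha hb
  obtain ⟨a, ha, b, hb, h⟩ := Submodule.mem_sup.1 this
  exact ⟨a, ha, b, hb, h.symm⟩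

theorem grD_comm_gen {x y : ExteriorAlgebra F M} {a b : ℕ} (hx : x ∈ grD F M a)
    (hy : y ∈ grD F M b) : x * y = (-1 : F) ^ (a * b) • (y * x) := by
  induction hx using Submodule.span_induction with
  | mem x hx =>
    obtain ⟨l, h1, h2, rfl⟩ := hx
    induction hy using Submodule.span_induction with
    | mem y hy =>
      obtain ⟨l', h1', h2', rfl⟩ := hy
      rw [anti3]
      congr 1
      rw [neg_one_pow_eq_pow_mod_two, Nat.mul_mod, h2, h2', ← Nat.mul_mod,
        ← neg_one_pow_eq_pow_mod_two]
    | zero => simp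
    | add y z _ _ h1 h2 => rw [mul_add, add_mul, h1, h2, smul_add]
    | smul c y _ h => rw [mul_smul_comm, smul_mul_assoc, h, smul_comm]
  | zero => simp
  | add y z _ _ h1 h2 => rw [mul_add, add_mul, h1, h2, smul_add]
  | smul c y _ h => rw [mul_smul_comm, smul_mul_assoc, h, smul_comm]

theorem grD_central {x : ExteriorAlgebra F M} {a : ℕ} (hx : x ∈ grD F M a) (ha : Even a)
    (y : ExteriorAlgebra F M) : x * y = y * x := by
  obtain ⟨p, hp, q, hq, rfl⟩ := grD_top y
  rw [mul_add, add_mul, grD_comm_gen hx hp, grD_comm_gen hx hq]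
  simp [ha.neg_one_pow]

theorem grD_anti {x y : ExteriorAlgebra F M} (hx : x ∈ grD F M 1) (hy : y ∈ grD F M 1) :
    x * y = -(y * x) := by
  rw [grD_comm_gen hx hy]; simp

theorem prod_mem_grD {n : ℕ} (S : Finset (Fin n)) (x : Fin n → ExteriorAlgebra F M)
    (h1 : ∀ i ∈ S, x i ∈ grD F M 1) (h0 : ∀ i, i ∉ S → x i ∈ grD F M 0) (l : List (Fin n)) :
    (l.map x).prod ∈ grD F M (l.filter (fun i => decide (i ∈ S))).length := by
  induction l with
  | nil => simpa using grD_one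
  | cons a l ih =>
    rw [List.map_cons, List.prod_cons]
    by_cases ha : a ∈ S
    · have := grD_mul (h1 a ha) ih
      simpa [ha, add_comm] using this
    · have := grD_mul (h0 a ha) ih
      simpa [ha] using this

theorem grD_bot [Module.Finite F M] {m : ℕ} (h : Module.finrank F M < m) : grD F M m = ⊥ := by
  rw [grD, Submodule.span_eq_bot]
  rintro _ ⟨l, h1, h2, rfl⟩
  have e : (l.map (ExteriorAlgebra.ι F)).prod = ExteriorAlgebra.ιMulti F l.length l.get := by
    rw [ExteriorAlgebra.ιMulti_apply]
    congr 1
    conv_lhs => rw [← List.ofFn_get l, List.map_ofFn]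
    rfl
  rw [e]
  apply AlternatingMap.map_linearDependent
  intro hli
  have := hli.fintype_card_le_finrank
  simp at this
  omega

theorem ιMulti_ne_zero {m : ℕ} {v : Fin m → M} (hv : LinearIndependent F v) :
    ExteriorAlgebra.ιMulti F m v ≠ 0 := by
  have h := exteriorPower.ιMulti_family_linearIndependent_field (K := F) m hv
  have h2 := h.ne_zero (Set.powersetCard.ofFinEmbEquiv (RelEmbedding.refl _))
  intro h3
  apply h2
  apply Subtype.ext
  rw [exteriorPower.ιMulti_family_apply_coe, ExteriorAlgebra.ιMulti_family, Equiv.symm_apply_apply]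
  exact h3

/-- products of distinct basis vectors are nonzero -/
theorem prod_basis_ne_zero {N : ℕ} (q : List (Fin N)) (hq : q.Nodup) :
    (q.map (fun i => ExteriorAlgebra.ι F (Pi.single i 1 : Fin N → F))).prod ≠ 0 := by
  have hv : LinearIndependent F (fun j : Fin q.length => (Pi.single (q.get j) 1 : Fin N → F)) := by
    have := (Pi.basisFun F (Fin N)).linearIndependent
    have := this.comp q.get (List.nodup_iff_injective_get.1 hq)
    convert this using 1
    ext j : 1
    simp
  have := ιMulti_ne_zero hv
  rw [ExteriorAlgebra.ιMulti_apply] at this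
  convert this using 2
  conv_lhs => rw [← List.ofFn_get q, List.map_ofFn]
  rfl
end gr

/-! ### Coordinates on multilinear polynomials -/

/-- index type of the multilinear monomials -/
abbrev Ix (n : ℕ) : Type := Equiv.Perm (Fin n) × (Fin n → Bool)

/-- the multilinear monomials -/
def mono (F : Type) [Field F] (n : ℕ) (p : Ix n) : FA F :=
  (List.ofFn fun i : Fin n =>
        if p.2 (p.1 i) then zv F (p.1 i).val else yv F (p.1 i).val).prod

/-- linear combinations of the multilinear monomials -/
def LL (F : Type) [Field F] (n : ℕ) : (Ix n → F) →ₗ[F] FA F :=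
  Fintype.linearCombination F (mono F n)

theorem LL_range (F : Type) [Field F] (n : ℕ) : LinearMap.range (LL F n) = PnGr F n := by
  rw [LL, Fintype.range_linearCombination, PnGr]
  congr 1
  ext m
  constructor
  · rintro ⟨⟨σ, w⟩, rfl⟩
    exact ⟨σ, w, rfl⟩
  · rintro ⟨σ, w, rfl⟩
    exact ⟨⟨σ, w⟩, rfl⟩

open Classical in
/-- the sign functionals -/
def pf (F : Type) [Field F] {n : ℕ} (S : Finset (Fin n)) : (Ix n → F) →ₗ[F] F :=
  Fintype.linearCombination F
    (fun p : Ix n => if p.2 = (fun _ => false) then psg F S (List.ofFn p.1) else 0)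

theorem ofFn_perm_nodup {n : ℕ} (σ : Equiv.Perm (Fin n)) : (List.ofFn σ).Nodup :=
  List.nodup_ofFn.2 σ.injective

theorem ofFn_perm_mem {n : ℕ} (σ : Equiv.Perm (Fin n)) (i : Fin n) : i ∈ List.ofFn σ := by
  rw [List.mem_ofFn]; exact σ.surjective i

theorem exists_perm_ofFn {n : ℕ} (l : List (Fin n)) (hl : l.Nodup) (hall : ∀ i, i ∈ l) :
    ∃ σ : Equiv.Perm (Fin n), List.ofFn σ = l := by
  have hn : n = l.length := by
    have : l.toFinset = Finset.univ := by ext i; simp [hall]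
    rw [← List.toFinset_card_of_nodup hl, this]; simp
  refine ⟨(finCongr hn).trans (List.Nodup.getEquivOfForallMemList l hl hall), ?_⟩
  apply List.ext_getElem
  · simp [← hn]
  · intro i h1 h2
    simp

theorem pf_rel (F : Type) [Field F] {n : ℕ} (S : Finset (Fin n)) (v : Ix n → F) :
    ∑ j ∈ S, (-1 : F) ^ (S.filter (fun b => b < j)).card * pf F (S.erase j) v
      = (if Even S.card then 0 else 1) * pf F S v := by
  classical
  simp only [pf, Fintype.linearCombination_apply, Finset.mul_sum, smul_eq_mul]
  rw [Finset.sum_comm]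
  apply Finset.sum_congr rfl
  intro p _
  by_cases hp : p.2 = (fun _ => false)
  · simp only [hp, if_true]
    have := psg_rel F S (List.ofFn p.1) (ofFn_perm_nodup _) (ofFn_perm_mem _)
    rw [mul_left_comm, ← this, Finset.mul_sum]
    apply Finset.sum_congr rfl
    intro j _
    ring
  · simp [hp]

open Classical in
/-- evaluation of a multilinear polynomial with the odd variables sent to zero -/
theorem eval_LL (F : Type) [Field F] {A : Type} [Ring A] [Algebra F A] {n : ℕ}
    (φ : FA F →ₐ[F] A) (hz : ∀ j, φ (zv F j) = 0) (v : Ix n → F) :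
    φ (LL F n v) = ∑ p : Ix n, v p • (if p.2 = (fun _ => false) then
      ((List.ofFn p.1).map (fun i : Fin n => φ (yv F i))).prod else 0) := by
  rw [LL, Fintype.linearCombination_apply, map_sum]
  apply Finset.sum_congr rfl
  rintro ⟨σ, w⟩ _
  rw [map_smul]
  congr 1
  by_cases hp : w = (fun _ => false)
  · subst hp
    simp [mono, map_list_prod, List.map_ofFn, Function.comp_def]
  · simp only [hp, if_false, mono]
    rw [map_list_prod, List.map_ofFn]
    apply List.prod_eq_zero
    have : ∃ i, w i = true := by
      by_contra h
      push Not at h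
      exact hp (funext fun i => by simpa using h i)
    obtain ⟨i, hi⟩ := this
    rw [List.mem_ofFn]
    exact ⟨σ.symm i, by simp [hi, hz]⟩

open Classical in
theorem eval_sort (F : Type) [Field F] {A : Type} [Ring A] [Algebra F A] {n : ℕ}
    (S : Finset (Fin n)) (x : Fin n → A)
    (hodd : ∀ i ∈ S, ∀ j ∈ S, x i * x j = -(x j * x i))
    (heven : ∀ i, i ∉ S → ∀ y, x i * y = y * x i) (v : Ix n → F) :
    ∑ p : Ix n, v p • (if p.2 = (fun _ => false) then
      ((List.ofFn p.1).map x).prod else 0) = pf F S v • ((fullW n).map x).prod := by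
  rw [pf, Fintype.linearCombination_apply, Finset.sum_smul]
  apply Finset.sum_congr rfl
  rintro ⟨σ, w⟩ _
  by_cases hp : w = (fun _ => false)
  · simp only [hp, if_true]
    rw [word_sort F S x hodd heven, sort_full _ (ofFn_perm_nodup _) (ofFn_perm_mem _), smul_eq_mul,
      smul_smul]
  · simp [hp]

open Classical in
theorem eval_add (F : Type) [Field F] {A : Type} [Ring A] [Algebra F A] {n : ℕ}
    (a b : Fin n → A) (v : Ix n → F) :
    ∑ p : Ix n, v p • (if p.2 = (fun _ => false) then
      ((List.ofFn p.1).map (b + a)).prod else 0) =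
    ∑ S : Finset (Fin n), ∑ p : Ix n, v p • (if p.2 = (fun _ => false) then
      ((List.ofFn p.1).map (S.piecewise b a)).prod else 0) := by
  rw [Finset.sum_comm]
  apply Finset.sum_congr rfl
  rintro ⟨σ, w⟩ _
  rw [← Finset.smul_sum]
  congr 1
  by_cases hp : w = (fun _ => false)
  · simp only [hp, if_true]
    have h := ((MultilinearMap.mkPiAlgebraFin F n A).domDomCongr σ).map_add_univ b a
    simp only [MultilinearMap.domDomCongr_apply, MultilinearMap.mkPiAlgebraFin_apply] at h
    simp only [List.map_ofFn, Function.comp_def]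
    exact h
  · simp [hp]

theorem exists_emb {n N : ℕ} (hN : 0 < N) (S : Finset (Fin n)) (hS : S.card ≤ N) :
    ∃ g : Fin n → Fin N, Set.InjOn g S ∧ (S.card < N → ∃ j0, ∀ i ∈ S, g i ≠ j0) := by
  classical
  obtain ⟨e⟩ : Nonempty (S ↪ Fin N) := Function.Embedding.nonempty_of_card_le (by simpa using hS)
  let g : Fin n → Fin N := fun i => if h : i ∈ S then e ⟨i, h⟩ else ⟨0, hN⟩
  refine ⟨g, ?_, ?_⟩
  · intro i hi j hj hij
    have hi' : i ∈ S := hi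
    have hj' : j ∈ S := hj
    simp only [g, hi', hj', dif_pos] at hij
    simpa using e.injective hij
  · intro h
    have : (S.image g).card < (Finset.univ : Finset (Fin N)).card := by
      simpa using lt_of_le_of_lt Finset.card_image_le h
    obtain ⟨j, _, hj⟩ := Finset.exists_mem_notMem_of_card_lt_card this
    refine ⟨j, fun i hi hij => hj ?_⟩
    rw [← hij]
    exact Finset.mem_image_of_mem _ hi

theorem prod_drop_ones {A : Type} [Monoid A] {n : ℕ} (S : Finset (Fin n)) (x : Fin n → A)
    (l : List (Fin n)) :
    (l.map (fun i => if i ∈ S then x i else 1)).prod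
      = ((l.filter (fun i => decide (i ∈ S))).map x).prod := by
  induction l with
  | nil => simp
  | cons a l ih => by_cases ha : a ∈ S <;> simp [ha, ih]

/-- the Grassmann algebra -/
abbrev GA (F : Type) [Field F] (N : ℕ) : Type := ExteriorAlgebra F (Fin N → F)

/-- the test substitution for the set `S` -/
theorem exists_test (F : Type) [Field F] {n N : ℕ} (hN : 0 < N) (S : Finset (Fin n))
    (hS : S.card ≤ N) : ∃ φ : FA F →ₐ[F] GA F N, IsGSubst F (GA F N) ⊤ ⊥ φ ∧
      ∃ E : GA F N, E ∈ grD F (Fin N → F) S.card ∧ E ≠ 0 ∧ (∀ v, φ (LL F n v) = pf F S v • E) ∧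
        (S.card < N → ∃ y ∈ grD F (Fin N → F) 1, E * y ≠ 0) := by
  classical
  obtain ⟨g, hg, hj⟩ := exists_emb hN S hS
  let b : Fin n → GA F N := fun i => ExteriorAlgebra.ι F (Pi.single (g i) 1)
  let x : Fin n → GA F N := fun i => if i ∈ S then b i else 1
  let φ : FA F →ₐ[F] GA F N := FreeAlgebra.lift F (fun s => match s with
    | Sum.inl i => if h : i < n then x ⟨i, h⟩ else 0
    | Sum.inr _ => 0)
  have hz : ∀ j, φ (zv F j) = 0 := by intro j; simp [φ, zv]
  have hy : ∀ i : Fin n, φ (yv F i) = x i := by intro i; simp [φ, yv]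
  have hb : ∀ i, b i ∈ grD F (Fin N → F) 1 := fun i =>
    Submodule.subset_span ⟨[Pi.single (g i) 1], by simp, by simp, by simp [b]⟩
  have hx1 : ∀ i ∈ S, x i ∈ grD F (Fin N → F) 1 := by
    intro i hi; simp only [x, hi, if_true]; exact hb i
  have hx0 : ∀ i, i ∉ S → x i ∈ grD F (Fin N → F) 0 := by
    intro i hi; simp only [x, hi, if_false]; exact grD_one
  set q := ((fullW n).filter (fun i => decide (i ∈ S))).map g with hq
  have hqn : q.Nodup := by
    apply List.Nodup.map_on _ ((fullW_nodup n).filter _)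
    intro i hi j hj' h
    simp at hi hj'
    exact hg hi.2 hj'.2 h
  have hE : ((fullW n).map x).prod
      = (q.map (fun i => ExteriorAlgebra.ι F (Pi.single i 1 : Fin N → F))).prod := by
    rw [show x = fun i => if i ∈ S then b i else 1 from rfl, prod_drop_ones S b, hq, List.map_map]
    rfl
  refine ⟨φ, ⟨fun i => Submodule.mem_top, fun j => by rw [hz]; exact Submodule.zero_mem _⟩,
    ((fullW n).map x).prod, ?_, ?_, ?_, ?_⟩
  · have := prod_mem_grD S x hx1 hx0 (fullW n)
    rwa [fullW_filter_length] at this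
  · rw [hE]; exact prod_basis_ne_zero q hqn
  · intro v
    rw [eval_LL F φ hz]
    simp only [hy]
    exact eval_sort F S x (fun i hi j hj => grD_anti (hx1 i hi) (hx1 j hj))
      (fun i hi y => grD_central (hx0 i hi) (by simp) y) v
  · intro hlt
    obtain ⟨j0, hj0⟩ := hj hlt
    refine ⟨ExteriorAlgebra.ι F (Pi.single j0 1), Submodule.subset_span ⟨[Pi.single j0 1], by simp⟩, ?_⟩
    rw [hE]
    have := prod_basis_ne_zero (F := F) (q ++ [j0]) (by
      rw [List.nodup_append]
      refine ⟨hqn, by simp, ?_⟩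
      intro a ha c hc hac
      simp [hq, mem_fullW] at ha hc
      obtain ⟨i, hi, rfl⟩ := ha
      exact hj0 i hi (hac.trans hc))
    simpa using this

/-- expansion of an arbitrary substitution -/
theorem eval_expand (F : Type) [Field F] {n N : ℕ} (φ : FA F →ₐ[F] GA F N)
    (hφ : IsGSubst F (GA F N) ⊤ ⊥ φ) :
    ∃ E : Finset (Fin n) → GA F N, (∀ S, E S ∈ grD F (Fin N → F) S.card) ∧
      ∀ v, φ (LL F n v) = ∑ S : Finset (Fin n), pf F S v • E S := by
  classical
  have hz : ∀ j, φ (zv F j) = 0 := fun j => by simpa using hφ.2 j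
  have hdec := fun i : Fin n => grD_top (φ (yv F i))
  choose a ha b hb hab using hdec
  have h1 : ∀ S : Finset (Fin n), ∀ i ∈ S, S.piecewise b a i ∈ grD F (Fin N → F) 1 := by
    intro S i hi; rw [Finset.piecewise_eq_of_mem _ _ _ hi]; exact hb i
  have h0 : ∀ S : Finset (Fin n), ∀ i, i ∉ S → S.piecewise b a i ∈ grD F (Fin N → F) 0 := by
    intro S i hi; rw [Finset.piecewise_eq_of_notMem _ _ _ hi]; exact ha i
  refine ⟨fun S => ((fullW n).map (S.piecewise b a)).prod, ?_, ?_⟩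
  · intro S
    have := prod_mem_grD S _ (h1 S) (h0 S) (fullW n)
    rwa [fullW_filter_length] at this
  · intro v
    rw [eval_LL F φ hz]
    have hx : (fun i : Fin n => φ (yv F i)) = b + a := by
      funext i; rw [hab i, Pi.add_apply, add_comm]
    simp only [hx]
    rw [eval_add]
    apply Finset.sum_congr rfl
    intro S _
    exact eval_sort F S _ (fun i hi j hj => grD_anti (h1 S i hi) (h1 S j hj))
      (fun i hi y => grD_central (h0 S i hi) (by simp) y) v

theorem mem_Id_iff (F : Type) [Field F] {n N : ℕ} (hN : 0 < N) (v : Ix n → F) :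
    LL F n v ∈ IdGr F (GA F N) ⊤ ⊥ ↔ ∀ S : Finset (Fin n), S.card ≤ N → pf F S v = 0 := by
  constructor
  · intro h S hS
    obtain ⟨φ, hφ, E, -, hE, hev, -⟩ := exists_test F hN S hS
    have := h φ hφ
    rw [hev] at this
    exact (smul_eq_zero.1 this).resolve_right hE
  · intro h φ hφ
    obtain ⟨E, hE, hev⟩ := eval_expand (n := n) F φ hφ
    rw [hev]
    apply Finset.sum_eq_zero
    intro S _
    by_cases hS : S.card ≤ N
    · rw [h S hS, zero_smul]
    · have := hE S
      rw [grD_bot (by simpa using hS), Submodule.mem_bot] at this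
      rw [this, smul_zero]

theorem const_LL (F : Type) [Field F] {n : ℕ} (hn : 1 ≤ n) (v : Ix n → F) :
    constTerm F (LL F n v) = 0 := by
  rw [LL, Fintype.linearCombination_apply, map_sum]
  apply Finset.sum_eq_zero
  rintro ⟨σ, w⟩ _
  rw [map_smul, mono, map_list_prod, List.map_ofFn]
  rw [List.prod_eq_zero, smul_zero]
  rw [List.mem_ofFn]
  refine ⟨⟨0, hn⟩, ?_⟩
  simp only [Function.comp_apply]
  split_ifs <;> simp [constTerm, zv, yv]

theorem mem_C_iff (F : Type) [Field F] [CharZero F] {n N : ℕ} (hN : 0 < N) (hNe : Even N)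
    (hn : 1 ≤ n) (v : Ix n → F) :
    LL F n v ∈ CGr F (GA F N) ⊤ ⊥ ↔
      ∀ S : Finset (Fin n), ¬ Even S.card → S.card ≤ N → pf F S v = 0 := by
  constructor
  · intro h S hodd hS
    obtain ⟨φ, hφ, E, hED, hE, hev, hy⟩ := exists_test F hN S hS
    have hlt : S.card < N := lt_of_le_of_ne hS (fun h => hodd (h ▸ hNe))
    obtain ⟨y, hy1, hEy⟩ := hy hlt
    have hc := (h.2 φ hφ).2 y (by simp)
    rw [hev, smul_mul_assoc, mul_smul_comm, grD_comm_gen hy1 hED] at hc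
    rw [one_mul, (Nat.not_even_iff_odd.1 hodd).neg_one_pow, neg_one_smul, smul_neg,
      eq_neg_iff_add_eq_zero, ← two_smul F, smul_smul] at hc
    have := (smul_eq_zero.1 hc).resolve_right hEy
    simpa using this
  · intro h
    refine ⟨const_LL F hn v, fun φ hφ => ⟨by simp, fun y _ => ?_⟩⟩
    obtain ⟨E, hE, hev⟩ := eval_expand (n := n) F φ hφ
    rw [hev, Finset.sum_mul, Finset.mul_sum]
    apply Finset.sum_congr rfl
    intro S _
    by_cases he : Even S.card
    · rw [smul_mul_assoc, mul_smul_comm, grD_central (hE S) he]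
    by_cases hS : S.card ≤ N
    · rw [h S he hS]; simp
    · have := hE S
      rw [grD_bot (by simpa using hS), Submodule.mem_bot] at this
      rw [this]; simp

/-! ### Dimension counts -/

/-- index sets: even subsets of `X` of size less than `2 q` -/
def evI {n : ℕ} (q : ℕ) (X : Finset (Fin n)) : Finset (Finset (Fin n)) :=
  (Finset.range q).biUnion (fun i => X.powersetCard (2 * i))

theorem mem_evI {n q : ℕ} {X T : Finset (Fin n)} :
    T ∈ evI q X ↔ T ⊆ X ∧ Even T.card ∧ T.card < 2 * q := by
  simp only [evI, Finset.mem_biUnion, Finset.mem_range, Finset.mem_powersetCard]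
  constructor
  · rintro ⟨i, hi, h1, h2⟩
    exact ⟨h1, by rw [h2]; simp, by omega⟩
  · rintro ⟨h1, ⟨r, hr⟩, h3⟩
    exact ⟨r, by omega, h1, by omega⟩

theorem card_evI {n : ℕ} (q : ℕ) (X : Finset (Fin n)) :
    (evI q X).card = ∑ i ∈ Finset.range q, Nat.choose X.card (2 * i) := by
  rw [evI, Finset.card_biUnion]
  · simp
  · intro i _ j _ hij
    rw [Function.onFun, Finset.disjoint_left]
    intro T h1 h2
    rw [Finset.mem_powersetCard] at h1 h2
    omega

theorem pf_surj (F : Type) [Field F] [CharZero F] {n : ℕ} (I : Finset (Finset (Fin n)))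
    (g : Finset (Fin n) → Finset (Fin n)) (heven : ∀ T ∈ I, Even T.card)
    (hsub : ∀ T ∈ I, T ⊆ g T) (htri : ∀ T ∈ I, ∀ T' ∈ I, T ⊆ g T' → T ⊆ T') :
    Function.Surjective (LinearMap.pi (fun T : I => pf F (g T)) : (Ix n → F) →ₗ[F] (I → F)) := by
  classical
  rw [← LinearMap.range_eq_top]
  by_contra hne
  obtain ⟨f, hf, hle⟩ := Submodule.exists_le_ker_of_lt_top _ (lt_top_iff_ne_top.2 hne)
  apply hf
  let c : Finset (Fin n) → F := fun T => if h : T ∈ I then f (Pi.single ⟨T, h⟩ 1) else 0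
  have hc : ∀ T ∈ I, c T = 0 := by
    apply psg_indep F I g heven hsub htri c
    intro l hl hall
    obtain ⟨σ, rfl⟩ := exists_perm_ofFn l hl hall
    have h0 : f ((LinearMap.pi (fun T : I => pf F (g T)) : (Ix n → F) →ₗ[F] (I → F))
      (Pi.single (σ, fun _ => false) 1)) = 0 := hle ⟨_, rfl⟩
    rw [LinearMap.pi_apply_eq_sum_univ f] at h0
    rw [← h0, ← Finset.sum_coe_sort I]
    apply Finset.sum_congr rfl
    rintro ⟨T, hT⟩ _
    have e : (fun j => if (⟨T, hT⟩ : I) = j then (1 : F) else 0) = Pi.single (⟨T, hT⟩ : I) 1 := by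
      funext j
      by_cases h : (⟨T, hT⟩ : I) = j
      · subst h; simp
      · rw [Pi.single_eq_of_ne (Ne.symm h)]; simp [h]
    rw [e]
    simp [c, hT, pf, mul_comm]
  apply LinearMap.pi_ext'
  rintro ⟨T, hT⟩
  apply LinearMap.ext_ring
  have := hc T hT
  simpa [c, hT] using this

theorem finrank_aux (F : Type) [Field F] {n : ℕ} (C : Submodule F (FA F)) {J : Type} [Fintype J]
    (Φ : (Ix n → F) →ₗ[F] (J → F)) (hs : Function.Surjective Φ)
    (h : ∀ v, LL F n v ∈ C ↔ Φ v = 0) : scodim F (PnGr F n) C = Fintype.card J := by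
  rw [scodim, ← LL_range]
  let ψ := (Submodule.comap (LinearMap.range (LL F n)).subtype C).mkQ ∘ₗ (LL F n).rangeRestrict
  have hψ : Function.Surjective ψ :=
    (Submodule.mkQ_surjective _).comp (LinearMap.surjective_rangeRestrict _)
  have hk : LinearMap.ker ψ = LinearMap.ker Φ := by
    ext v
    simp only [ψ, LinearMap.mem_ker, LinearMap.comp_apply, Submodule.mkQ_apply,
      Submodule.Quotient.mk_eq_zero, Submodule.mem_comap]
    exact h v
  have e := (ψ.quotKerEquivOfSurjective hψ).symm.trans
    ((Submodule.quotEquivOfEq _ _ hk).trans (Φ.quotKerEquivOfSurjective hs))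
  rw [e.finrank_eq, Module.finrank_pi]

theorem delta_aux (F : Type) [Field F] {n : ℕ} (C I : Submodule F (FA F))
    (hle : PnGr F n ⊓ I ≤ PnGr F n ⊓ C) :
    scodim F (PnGr F n) I = scodim F (PnGr F n) C + deltaDim F (PnGr F n) C I := by
  have hfin : Module.Finite F (PnGr F n) := by
    rw [← LL_range]; infer_instance
  have hfin2 : Module.Finite F ↥(PnGr F n ⊓ C) :=
    Submodule.finiteDimensional_inf_left _ _
  have key : ∀ X : Submodule F (FA F), scodim F (PnGr F n) X + Module.finrank F ↥(PnGr F n ⊓ X)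
      = Module.finrank F (PnGr F n) := by
    intro X
    have h := Submodule.finrank_quotient_add_finrank (Submodule.comap (PnGr F n).subtype X)
    rw [← Submodule.finrank_map_subtype_eq, Submodule.map_comap_subtype] at h
    exact h
  have h1 := key C
  have h2 := key I
  have h3 := Submodule.finrank_quotient_add_finrank
    (Submodule.comap (PnGr F n ⊓ C).subtype (PnGr F n ⊓ I))
  rw [(Submodule.comapSubtypeEquivOfLe hle).finrank_eq] at h3
  rw [deltaDim]
  omega

theorem scodim_C (F : Type) [Field F] [CharZero F] (k n : ℕ) (hk : 1 ≤ k) (hn : 1 ≤ n) :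
    scodim F (PnGr F n) (CGr F (GA F (2 * k)) ⊤ ⊥) =
      ∑ i ∈ Finset.range k, Nat.choose (n - 1) (2 * i) := by
  let z : Fin n := ⟨0, hn⟩
  set I := evI k ((Finset.univ : Finset (Fin n)).erase z) with hI
  have hz : ∀ T ∈ I, z ∉ T := by
    intro T hT hzT
    have := (mem_evI.1 hT).1 hzT
    simp at this
  have hs := pf_surj F I (fun T => insert z T) (fun T hT => (mem_evI.1 hT).2.1)
    (fun T _ => Finset.subset_insert _ _) (fun T hT T' hT' h =>
      (Finset.subset_insert_iff_of_notMem (hz T hT)).1 h)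
  rw [finrank_aux F _ _ hs, Fintype.card_coe, hI, card_evI]
  · simp
  intro v
  rw [mem_C_iff F (by omega) (by simp) hn]
  constructor
  · intro h
    funext T
    obtain ⟨T, hT⟩ := T
    have hc := Finset.card_insert_of_notMem (hz T hT)
    obtain ⟨-, h2, h3⟩ := mem_evI.1 hT
    apply h
    · rw [hc, Nat.even_add_one, not_not]; exact h2
    · rw [hc]; omega
  · intro h
    have hin : ∀ S : Finset (Fin n), z ∈ S → ¬ Even S.card → S.card ≤ 2 * k → pf F S v = 0 := by
      intro S hzS ho hS
      have hc := Finset.card_erase_add_one hzS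
      have hT : S.erase z ∈ I := by
        rw [hI, mem_evI]
        refine ⟨Finset.erase_subset_erase _ (Finset.subset_univ _), ?_, by omega⟩
        rw [← hc, Nat.even_add_one, not_not] at ho
        exact ho
      have := congrFun h ⟨_, hT⟩
      simpa [Finset.insert_erase hzS] using this
    intro S ho hS
    by_cases hzS : z ∈ S
    · exact hin S hzS ho hS
    have hc := Finset.card_insert_of_notMem hzS
    have hrel := pf_rel F (insert z S) v
    rw [if_pos (by rw [hc, Nat.even_add_one]; exact ho), zero_mul,
      Finset.sum_insert hzS, Finset.erase_insert hzS, Finset.sum_eq_zero, add_zero] at hrel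
    · simpa using hrel
    · intro j hj
      have hc2 := Finset.card_erase_add_one (Finset.mem_insert_of_mem (b := z) hj)
      have hc3 : ((insert z S).erase j).card = S.card := by omega
      rw [hin, mul_zero]
      · rw [Finset.mem_erase]
        exact ⟨by rintro rfl; exact hzS hj, Finset.mem_insert_self _ _⟩
      · rwa [hc3]
      · rwa [hc3]

theorem scodim_I (F : Type) [Field F] [CharZero F] (k n : ℕ) (hk : 1 ≤ k) :
    scodim F (PnGr F n) (IdGr F (GA F (2 * k)) ⊤ ⊥) =
      ∑ i ∈ Finset.range (k + 1), Nat.choose n (2 * i) := by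
  set I := evI (k + 1) (Finset.univ : Finset (Fin n)) with hI
  have hs := pf_surj F I (fun T => T) (fun T hT => (mem_evI.1 hT).2.1)
    (fun T _ => subset_rfl) (fun T hT T' hT' h => h)
  rw [finrank_aux F _ _ hs, Fintype.card_coe, hI, card_evI]
  · simp
  intro v
  rw [mem_Id_iff F (by omega)]
  constructor
  · intro h
    funext T
    obtain ⟨T, hT⟩ := T
    obtain ⟨-, ⟨r, hr⟩, h3⟩ := mem_evI.1 hT
    exact h T (by omega)
  · intro h
    have hin : ∀ S : Finset (Fin n), Even S.card → S.card ≤ 2 * k → pf F S v = 0 := by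
      intro S he hS
      exact congrFun h ⟨S, mem_evI.2 ⟨Finset.subset_univ _, he, by omega⟩⟩
    intro S hS
    by_cases he : Even S.card
    · exact hin S he hS
    have hrel := pf_rel F S v
    rw [if_neg he, one_mul] at hrel
    rw [← hrel]
    apply Finset.sum_eq_zero
    intro j hj
    have hc := Finset.card_erase_add_one hj
    rw [hin, mul_zero]
    · rw [← hc, Nat.even_add_one, not_not] at he
      exact he
    · omega

theorem choose_sum (m k : ℕ) :
    ∑ i ∈ Finset.range (k + 1), Nat.choose (m + 1) (2 * i) =
      ∑ i ∈ Finset.range (k + 1), Nat.choose m (2 * i) +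
        ∑ i ∈ Finset.range k, Nat.choose m (2 * i + 1) := by
  induction k with
  | zero => simp
  | succ k ih =>
    have e1 := Finset.sum_range_succ (fun i => Nat.choose (m + 1) (2 * i)) (k + 1)
    have e2 := Finset.sum_range_succ (fun i => Nat.choose m (2 * i)) (k + 1)
    have e3 := Finset.sum_range_succ (fun i => Nat.choose m (2 * i + 1)) k
    have e4 : Nat.choose (m + 1) (2 * (k + 1)) =
      Nat.choose m (2 * k + 1) + Nat.choose m (2 * (k + 1)) := Nat.choose_succ_succ m (2 * k + 1)
    omega

/-- for `k ≥ 1`, `n ≥ 1`, the Grassmann algebra `G_{2k}` on `2k`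
generators, with the trivial grading, satisfies
`c_n^{gr,z}(G_{2k}) = Σ_{i=0}^{k-1} C(n-1,2i)` and
`δ_n^{gr}(G_{2k}) = C(n,2k) + Σ_{i=0}^{k-2} C(n-1,2i+1)`. -/
theorem stmt13 (F : Type) [Field F] [CharZero F] (k n : ℕ) (hk : 1 ≤ k) (hn : 1 ≤ n) :
    scodim F (PnGr F n)
        (CGr F (ExteriorAlgebra F (Fin (2 * k) → F)) ⊤ ⊥) =
      ∑ i ∈ Finset.range k, Nat.choose (n - 1) (2 * i) ∧
    deltaDim F (PnGr F n)
        (CGr F (ExteriorAlgebra F (Fin (2 * k) → F)) ⊤ ⊥)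
        (IdGr F (ExteriorAlgebra F (Fin (2 * k) → F)) ⊤ ⊥) =
      Nat.choose n (2 * k) + ∑ i ∈ Finset.range (k - 1), Nat.choose (n - 1) (2 * i + 1) := by
  have hC := scodim_C F k n hk hn
  have hI := scodim_I F k n hk
  refine ⟨hC, ?_⟩
  have hle : PnGr F n ⊓ IdGr F (GA F (2 * k)) ⊤ ⊥ ≤ PnGr F n ⊓ CGr F (GA F (2 * k)) ⊤ ⊥ := by
    rintro f ⟨hf, hf2⟩
    refine ⟨hf, ?_⟩
    have hf' := hf
    rw [← LL_range] at hf'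
    obtain ⟨v, rfl⟩ := hf'
    refine ⟨const_LL F hn v, fun φ hφ => ?_⟩
    rw [hf2 φ hφ]
    exact Submodule.zero_mem _
  have hd := delta_aux F _ _ hle
  rw [hC, hI] at hd
  obtain ⟨m, rfl⟩ : ∃ m, n = m + 1 := ⟨n - 1, by omega⟩
  obtain ⟨k, rfl⟩ : ∃ j, k = j + 1 := ⟨k - 1, by omega⟩
  rw [Finset.sum_range_succ, choose_sum] at hd
  simp only [Nat.add_sub_cancel] at hd ⊢
  change deltaDim F (PnGr F (m + 1)) (CGr F (GA F (2 * (k + 1))) ⊤ ⊥)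
    (IdGr F (GA F (2 * (k + 1))) ⊤ ⊥) = _
  omega
end
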